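/- Let A be the 7×7 Cartan matrix of type E_7 with nodes labeled so that nodes 1–2–3–4–5–6 form a chain and node 7 is attached to node 3 (A_{ii} = 2; A_{ij} = −1 exactly when {i,j} ∈ {{1,2},{2,3},{3,4},{4,5},{5,6},{3,7}}; A_{ij} = 0 otherwise). Let Φ⁺ = { c ∈ ℕ^7 : cᵀ A c = 2 }, which has exactly 63 elements (the positive roots of E_7). Then in ℤ[[q, y_1, …, y_7]]: ∏_{c ∈ Φ⁺} ∏_{n≥1} (1 − q^n y_1^{c_1} ⋯ y_7^{c_7})^{−1} = ∑ over all 7-tuples (r_1, …, r_7) of descending sequences of q^{E} · ( ∏_{i=1}^{7} y_i^{|r_i|} ) · ∏_{i=1}^{7} ∏_{j≥1} (q;q)_{r_i^{(j)} − r_i^{(j+1)}}^{−1}, where E = ∑_{i=1}^{7} ∑_{t≥1} (r_i^{(t)})² − ∑_{t≥1} ( r_1^{(t)} r_2^{(t)} + r_2^{(t)} r_3^{(t)} + r_3^{(t)} r_4^{(t)} + r_4^{(t)} r_5^{(t)} + r_5^{(t)} r_6^{(t)} + r_3^{(t)} r_7^{(t)} ); here E is a nonnegative integer. -/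

import Mathlib

open MvPowerSeries

/-- The product topology (coefficientwise convergence) on multivariate formal power series. -/
noncomputable instance (σ R : Type*) [TopologicalSpace R] :
    TopologicalSpace (MvPowerSeries σ R) :=
  inferInstanceAs (TopologicalSpace ((σ →₀ ℕ) → R))

/-- `r : ℕ → ℕ` is a descending sequence (indexed so that `r t = r^{(t+1)}`):
nonincreasing and eventually zero. -/
def IsDescending (r : ℕ → ℕ) : Prop :=
  Antitone r ∧ ∃ N, ∀ t ≥ N, r t = 0

/-- The Cartan matrix of type `E₇` (0-indexed: nodes `0–1–2–3–4–5` form a chain and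
node `6` is attached to node `2`; these are the paper's nodes `1,…,7`). -/
def cartanE7 : Matrix (Fin 7) (Fin 7) ℤ :=
  !![ 2, -1,  0,  0,  0,  0,  0;
     -1,  2, -1,  0,  0,  0,  0;
      0, -1,  2, -1,  0,  0, -1;
      0,  0, -1,  2, -1,  0,  0;
      0,  0,  0, -1,  2, -1,  0;
      0,  0,  0,  0, -1,  2,  0;
      0,  0, -1,  0,  0,  0,  2]

open Finset in
/-- The `q`-Pochhammer symbol `(q;q)_n`. -/
def qFactorial {A : Type*} [CommRing A] (q : A) (n : ℕ) : A :=
  ∏ u ∈ range n, (1 - q ^ (u + 1))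

theorem qFactorial_succ {A : Type*} [CommRing A] (q : A) (n : ℕ) :
    qFactorial q (n + 1) = qFactorial q n * (1 - q ^ (n + 1)) :=
  Finset.prod_range_succ _ _

namespace Partition

open Finset Finsupp

/-- The pairing `∑ₜ r t * m t` of finitely supported sequences. -/
def pair (r m : ℕ →₀ ℕ) : ℕ := r.sum fun t x => x * m t

theorem pair_add_left (r s m : ℕ →₀ ℕ) : pair (r + s) m = pair r m + pair s m :=
  Finsupp.sum_add_index' (by simp) (by intros; ring)

theorem pair_add_right (r s m : ℕ →₀ ℕ) : pair r (s + m) = pair r s + pair r m := by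
  simp [pair, mul_add, Finsupp.sum_add]

theorem pair_single_left (k x : ℕ) (m : ℕ →₀ ℕ) : pair (single k x) m = x * m k := by
  simp [pair]

theorem pair_single_right (k x : ℕ) (m : ℕ →₀ ℕ) : pair m (single k x) = m k * x := by
  classical
  simp [pair, Finsupp.sum, single_apply, mul_ite]
  intro h; simp [h]

theorem pair_zero_left (m : ℕ →₀ ℕ) : pair 0 m = 0 := by simp [pair]

theorem pair_zero_right (m : ℕ →₀ ℕ) : pair m 0 = 0 := by simp [pair]

theorem pair_comm (r m : ℕ →₀ ℕ) : pair r m = pair m r := by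
  induction r using Finsupp.induction_linear with
  | zero => simp [pair_zero_left, pair_zero_right]
  | add f g hf hg => rw [pair_add_left, pair_add_right, hf, hg]
  | single k x => rw [pair_single_left, pair_single_right, mul_comm]

/-- The sequence `1, …, 1, 0, 0, …` with `k` ones. -/
noncomputable def ones (k : ℕ) : ℕ →₀ ℕ := ∑ t ∈ range k, single t 1

theorem ones_zero : ones 0 = 0 := by simp [ones]

theorem ones_succ (k : ℕ) : ones (k + 1) = ones k + single k 1 := sum_range_succ _ _

theorem ones_apply (k t : ℕ) : ones k t = if t < k then 1 else 0 := by
  simp [ones, Finsupp.single_apply]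

theorem pair_ones_right (r : ℕ →₀ ℕ) (k : ℕ) : pair r (ones k) = ∑ t ∈ range k, r t := by
  induction k with
  | zero => simp [ones_zero, pair_zero_right]
  | succ k ih => rw [ones_succ, pair_add_right, ih, pair_single_right, mul_one, sum_range_succ]

theorem pair_ones_ones (k : ℕ) : pair (ones k) (ones k) = k := by
  rw [pair_ones_right, sum_congr rfl (g := fun _ => 1)]
  · simp
  · intro t ht; simp [ones_apply, mem_range.1 ht]

theorem degree_ones (k : ℕ) : (ones k).degree = k := by
  induction k with
  | zero => simp [ones_zero]
  | succ k ih => rw [ones_succ, map_add, ih, degree_single]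

theorem antitone_ones (k : ℕ) : Antitone (ones k) := by
  intro a b hab
  simp only [ones_apply]
  split_ifs <;> omega

theorem antitone_add_single {r : ℕ →₀ ℕ} (hr : Antitone r) {k : ℕ}
    (h : ∀ j, j + 1 = k → r k < r j) : Antitone (r + single k 1 : ℕ →₀ ℕ) := by
  refine antitone_nat_of_succ_le fun t => ?_
  have h1 := hr (Nat.le_succ t)
  have h2 := h t
  simp only [Finsupp.coe_add, Pi.add_apply, Finsupp.single_apply]
  rcases eq_or_ne k (t + 1) with rfl | hk
  · have := h2 rfl
    simp; omega
  · simp only [hk, if_false]; simp only [Nat.succ_eq_add_one] at h1; omega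

theorem exists_eq_add_single {r : ℕ →₀ ℕ} (hr : Antitone r) {k : ℕ} (h : r (k + 1) < r k) :
    ∃ s : ℕ →₀ ℕ, Antitone s ∧ r = s + single k 1 := by
  refine ⟨r - single k 1, antitone_nat_of_succ_le fun t => ?_, ?_⟩
  · have h1 : r (t + 1) ≤ r t := hr (Nat.le_succ t)
    rcases eq_or_ne k t with rfl | hk
    · simp only [tsub_apply, single_eq_same]; omega
    · rw [tsub_apply, tsub_apply, Finsupp.single_eq_of_ne hk.symm]; omega
  · ext t
    rcases eq_or_ne k t with rfl | hk
    · simp only [Finsupp.coe_add, Pi.add_apply, tsub_apply, single_eq_same]; omega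
    · simp [Finsupp.single_eq_of_ne hk.symm]

theorem exists_eq_add_ones {r : ℕ →₀ ℕ} (hr : Antitone r) {k : ℕ} (h : r (k + 1) < r k) :
    ∃ s : ℕ →₀ ℕ, Antitone s ∧ r = s + ones (k + 1) := by
  refine ⟨r - ones (k + 1), antitone_nat_of_succ_le fun t => ?_, ?_⟩
  · have h1 : r (t + 1) ≤ r t := hr (Nat.le_succ t)
    simp only [tsub_apply, ones_apply]
    rcases lt_trichotomy t k with hk | rfl | hk
    · rw [if_pos (by omega), if_pos (by omega)]; omega
    · rw [if_neg (by omega), if_pos (by omega)]; omega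
    · rw [if_neg (by omega), if_neg (by omega)]; omega
  · ext t
    simp only [Finsupp.coe_add, Pi.add_apply, tsub_apply, ones_apply]
    split_ifs with ht
    · have := hr (Nat.lt_succ_iff.1 ht); omega
    · omega

theorem eq_zero_of_degree_le {r : ℕ →₀ ℕ} (hr : Antitone r) {t : ℕ} (h : r.degree ≤ t) :
    r t = 0 := by
  by_contra h0
  have h1 : ∑ s ∈ range (t + 1), 1 ≤ ∑ s ∈ range (t + 1), r s := by
    refine sum_le_sum fun s hs => ?_
    have := hr (Nat.lt_succ_iff.1 (mem_range.1 hs)); omega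
  have h2 : ∑ s ∈ range (t + 1), r s ≤ r.degree := by
    rw [degree_apply]
    exact sum_le_sum_of_ne_zero (fun s _ hs => by simpa using hs)
  simp at h1
  omega

/-- The partitions of `n`, as descending finitely supported sequences. -/
noncomputable def partitions (n : ℕ) : Finset (ℕ →₀ ℕ) :=
  open scoped Classical in {r ∈ finsuppAntidiag (range n) n | Antitone r}

theorem mem_partitions {n : ℕ} {r : ℕ →₀ ℕ} :
    r ∈ partitions n ↔ Antitone r ∧ r.degree = n := by
  classical
  simp only [partitions, mem_filter, mem_finsuppAntidiag']
  constructor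
  · rintro ⟨⟨h1, h2⟩, h3⟩
    exact ⟨h3, h1⟩
  · rintro ⟨h3, h1⟩
    refine ⟨⟨h1, fun t ht => ?_⟩, h3⟩
    by_contra hn
    exact (mem_support_iff.1 ht) (eq_zero_of_degree_le h3 (by simpa [h1] using hn))

theorem partitions_zero : partitions 0 = {0} := by
  ext r
  rw [mem_partitions, mem_singleton]
  constructor
  · rintro ⟨-, h⟩
    exact (degree_eq_zero_iff r).1 h
  · rintro rfl
    exact ⟨fun _ _ _ => le_rfl, by simp⟩

section Weight

variable {K : Type*} [Field K] (q : K)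

/-- The product `∏ₜ 1 / (q;q)_{r t - r (t+1)}`. -/
noncomputable def invFactorials (r : ℕ →₀ ℕ) : K :=
  ∏ t ∈ r.support, (qFactorial q (r t - r (t + 1)))⁻¹

theorem invFactorials_eq {r : ℕ →₀ ℕ} {s : Finset ℕ} (hs : r.support ⊆ s) :
    invFactorials q r = ∏ t ∈ s, (qFactorial q (r t - r (t + 1)))⁻¹ := by
  refine prod_subset hs fun t _ ht => ?_
  simp [notMem_support_iff.1 ht, qFactorial]

variable {q}

theorem invFactorials_add_ones (hq : ∀ n, q ^ (n + 1) ≠ 1) {r : ℕ →₀ ℕ} (hr : Antitone r) (k : ℕ) :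
    invFactorials q (r + ones (k + 1)) * (1 - q ^ (r k + 1 - r (k + 1))) = invFactorials q r := by
  classical
  have h1 : r.support ⊆ r.support ∪ range (k + 1) := subset_union_left
  have h2 : (r + ones (k + 1)).support ⊆ r.support ∪ range (k + 1) := by
    intro t ht
    simp only [mem_support_iff, Finsupp.coe_add, Pi.add_apply, ones_apply] at ht
    simp only [mem_union, mem_support_iff, mem_range]
    by_contra hc
    push Not at hc
    simp [hc.1] at ht
    omega
  have hk : k ∈ r.support ∪ range (k + 1) := by simp
  rw [invFactorials_eq q h1, invFactorials_eq q h2, ← Finset.mul_prod_erase _ _ hk,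
    ← Finset.mul_prod_erase _ _ hk]
  have h3 : ∀ t ∈ (r.support ∪ range (k + 1)).erase k,
      (qFactorial q ((r + ones (k + 1)) t - (r + ones (k + 1)) (t + 1)))⁻¹ =
        (qFactorial q (r t - r (t + 1)))⁻¹ := by
    intro t ht
    have := ne_of_mem_erase ht
    congr 2
    simp only [Finsupp.coe_add, Pi.add_apply, ones_apply]
    split_ifs <;> omega
  rw [prod_congr rfl h3]
  have h4 : (r + ones (k + 1)) k - (r + ones (k + 1)) (k + 1) = (r k - r (k + 1)) + 1 := by
    have := hr (Nat.le_succ k)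
    simp only [Finsupp.coe_add, Pi.add_apply, ones_apply, Nat.succ_eq_add_one] at *
    simp; omega
  have h5 : r k + 1 - r (k + 1) = (r k - r (k + 1)) + 1 := by
    have := hr (Nat.le_succ k)
    simp only [Nat.succ_eq_add_one] at *
    omega
  have h6 : (1 - q ^ (r k - r (k + 1) + 1)) ≠ 0 := sub_ne_zero.2 (hq _).symm
  rw [h4, h5, qFactorial_succ, mul_inv]
  field_simp

theorem invFactorials_add_single_succ (hq : ∀ n, q ^ (n + 1) ≠ 1) {r : ℕ →₀ ℕ} (hr : Antitone r)
    {k : ℕ} (hk : r (k + 1) < r k) :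
    invFactorials q (r + single (k + 1) 1) * (1 - q ^ (r (k + 1) + 1 - r (k + 2))) =
      invFactorials q r * (1 - q ^ (r k - r (k + 1))) := by
  have h1 := invFactorials_add_ones hq hr (k + 1)
  have h2 := invFactorials_add_ones hq (r := r + single (k + 1) 1)
    (antitone_add_single hr (by rintro j hj; obtain rfl : j = k := by omega
                                exact hk)) k
  have h3 : r + single (k + 1) 1 + ones (k + 1) = r + ones (k + 1 + 1) := by
    rw [ones_succ (k + 1)]; abel
  rw [h3] at h2
  have h4 : (r + single (k + 1) 1 : ℕ →₀ ℕ) k + 1 - (r + single (k + 1) 1 : ℕ →₀ ℕ) (k + 1) =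
      r k - r (k + 1) := by
    simp
  rw [h4] at h2
  rw [← h2, ← h1]
  ring

theorem invFactorials_add_single_zero (hq : ∀ n, q ^ (n + 1) ≠ 1) {r : ℕ →₀ ℕ} (hr : Antitone r) :
    invFactorials q (r + single 0 1) * (1 - q ^ (r 0 + 1 - r 1)) = invFactorials q r := by
  have := invFactorials_add_ones hq hr 0
  rwa [ones_succ, ones_zero, zero_add] at this

variable (q) in
/-- The sum over partitions `r` of `n` of `g r`, weighted by
`q ^ (∑ₜ (r t)²) / ∏ₜ (q;q)_{r t - r (t+1)}`. -/
noncomputable def weightedSum (n : ℕ) (g : (ℕ →₀ ℕ) → K) : K :=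
  ∑ r ∈ partitions n, q ^ pair r r * invFactorials q r * g r

theorem weightedSum_congr {n : ℕ} {g h : (ℕ →₀ ℕ) → K}
    (H : ∀ r : ℕ →₀ ℕ, Antitone r → r.degree = n → g r = h r) : weightedSum q n g = weightedSum q n h :=
  sum_congr rfl fun r hr => by rw [H r (mem_partitions.1 hr).1 (mem_partitions.1 hr).2]

theorem weightedSum_sub (n : ℕ) (g h : (ℕ →₀ ℕ) → K) :
    weightedSum q n (fun r => g r - h r) = weightedSum q n g - weightedSum q n h := by
  simp [weightedSum, mul_sub]

theorem weightedSum_add (n : ℕ) (g h : (ℕ →₀ ℕ) → K) :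
    weightedSum q n (fun r => g r + h r) = weightedSum q n g + weightedSum q n h := by
  simp [weightedSum, mul_add, sum_add_distrib]

theorem weightedSum_sum {ι : Type*} (n : ℕ) (s : Finset ι) (g : ι → (ℕ →₀ ℕ) → K) :
    weightedSum q n (fun r => ∑ i ∈ s, g i r) = ∑ i ∈ s, weightedSum q n (g i) := by
  simp only [weightedSum, Finset.mul_sum]
  exact sum_comm

theorem weightedSum_const_mul (n : ℕ) (c : K) (g : (ℕ →₀ ℕ) → K) :
    weightedSum q n (fun r => c * g r) = c * weightedSum q n g := by
  simp only [weightedSum, Finset.mul_sum]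
  exact sum_congr rfl fun _ _ => by ring

/-- Reindexing a weighted sum along `r ↦ r + e`. -/
theorem weightedSum_shift {n : ℕ} {e : ℕ →₀ ℕ} {g h : (ℕ →₀ ℕ) → K}
    (hg : ∀ r : ℕ →₀ ℕ, Antitone r → (∀ s : ℕ →₀ ℕ, Antitone s → r ≠ s + e) → g r = 0)
    (hgh : ∀ r : ℕ →₀ ℕ, Antitone r → Antitone (r + e : ℕ →₀ ℕ) →
      q ^ pair (r + e) (r + e) * invFactorials q (r + e) * g (r + e) =
      q ^ pair r r * invFactorials q r * h r)
    (hh : ∀ r : ℕ →₀ ℕ, Antitone r → ¬ Antitone (r + e : ℕ →₀ ℕ) → h r = 0) :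
    weightedSum q (n + e.degree) g = weightedSum q n h := by
  symm
  refine sum_bij_ne_zero (fun r _ _ => r + e) ?_ ?_ ?_ ?_
  · intro r hr h0
    rw [mem_partitions] at hr ⊢
    refine ⟨?_, by rw [map_add, hr.2]⟩
    by_contra hc
    exact h0 (by rw [hh r hr.1 hc, mul_zero])
  · intro a _ _ b _ _ hab
    exact add_right_cancel hab
  · intro r hr h0
    rw [mem_partitions] at hr
    have : ∃ s : ℕ →₀ ℕ, Antitone s ∧ r = s + e := by
      by_contra hc
      push Not at hc
      exact h0 (by rw [hg r hr.1 hc, mul_zero])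
    obtain ⟨s, hs, rfl⟩ := this
    refine ⟨s, mem_partitions.2 ⟨hs, ?_⟩, ?_, rfl⟩
    · have := hr.2
      rw [map_add] at this; omega
    · rwa [← hgh s hs hr.1]
  · intro r hr h0
    rw [mem_partitions] at hr
    have : Antitone (r + e : ℕ →₀ ℕ) := by
      by_contra hc
      exact h0 (by rw [hh r hr.1 hc, mul_zero])
    exact (hgh r hr.1 this).symm

theorem inv_pow_sub_inv_pow (hq0 : q ≠ 0) {a b : ℕ} (h : b ≤ a) :
    q⁻¹ ^ a - q⁻¹ ^ b = q⁻¹ ^ a * (1 - q ^ (a - b)) := by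
  obtain ⟨c, rfl⟩ := Nat.exists_eq_add_of_le h
  simp only [add_tsub_cancel_left, pow_add, inv_pow]
  field_simp

/-- Removing a box from row `0`. -/
theorem weightedSum_single_zero (hq0 : q ≠ 0) (hq : ∀ n, q ^ (n + 1) ≠ 1) (n : ℕ)
    (g : (ℕ →₀ ℕ) → K) :
    weightedSum q (n + 1) (fun r => g r * (q⁻¹ ^ r 0 - q⁻¹ ^ r 1)) =
      weightedSum q n (fun r => g (r + single 0 1) * q ^ r 0) := by
  have := weightedSum_shift (q := q) (n := n) (e := single 0 1)
    (g := fun r => g r * (q⁻¹ ^ r 0 - q⁻¹ ^ r 1)) (h := fun r => g (r + single 0 1) * q ^ r 0)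
  rw [degree_single] at this
  apply this
  · intro r hr hs
    have h01 : r 1 ≤ r 0 := hr (Nat.zero_le 1)
    rcases h01.lt_or_eq with h | h
    · obtain ⟨s, hs1, hs2⟩ := exists_eq_add_single hr h
      exact absurd hs2 (hs s hs1)
    · simp [h]
  · intro r hr _
    have h01 : r 1 ≤ r 0 := hr (Nat.zero_le 1)
    have h1 := invFactorials_add_single_zero hq hr
    have h2 : (r + single 0 1 : ℕ →₀ ℕ) 0 = r 0 + 1 := by simp
    have h3 : (r + single 0 1 : ℕ →₀ ℕ) 1 = r 1 := by simp
    rw [← h1, h2, h3, inv_pow_sub_inv_pow hq0 (by omega), pair_add_left, pair_add_right,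
      pair_add_right, pair_single_left, pair_single_right, pair_single_left, Finsupp.single_eq_same]
    simp only [pow_add, mul_one, one_mul, pow_one, inv_pow]
    field_simp
  · intro r hr h
    exact absurd (antitone_add_single hr (by simp)) h

/-- Removing a box from row `k + 1`. -/
theorem weightedSum_single_succ (hq0 : q ≠ 0) (hq : ∀ n, q ^ (n + 1) ≠ 1) (n k : ℕ)
    (g : (ℕ →₀ ℕ) → K) :
    weightedSum q (n + 1) (fun r => g r * (q⁻¹ ^ r (k + 1) - q⁻¹ ^ r (k + 2))) =
      weightedSum q n (fun r => g (r + single (k + 1) 1) * (q ^ r (k + 1) - q ^ r k)) := by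
  have := weightedSum_shift (q := q) (n := n) (e := single (k + 1) 1)
    (g := fun r => g r * (q⁻¹ ^ r (k + 1) - q⁻¹ ^ r (k + 2)))
    (h := fun r => g (r + single (k + 1) 1) * (q ^ r (k + 1) - q ^ r k))
  rw [degree_single] at this
  apply this
  · intro r hr hs
    have h01 : r (k + 2) ≤ r (k + 1) := hr (Nat.le_succ _)
    rcases h01.lt_or_eq with h | h
    · obtain ⟨s, hs1, hs2⟩ := exists_eq_add_single hr h
      exact absurd hs2 (hs s hs1)
    · simp [h]
  · intro r hr h
    have hlt : r (k + 1) < r k := by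
      have := h (Nat.le_succ k)
      simpa using this
    have h12 : r (k + 2) ≤ r (k + 1) := hr (Nat.le_succ _)
    have h1 := invFactorials_add_single_succ hq hr hlt
    have h2 : (r + single (k + 1) 1 : ℕ →₀ ℕ) (k + 1) = r (k + 1) + 1 := by simp
    have h3 : (r + single (k + 1) 1 : ℕ →₀ ℕ) (k + 2) = r (k + 2) := by simp
    have h4 : q ^ r (k + 1) - q ^ r k = q ^ r (k + 1) * (1 - q ^ (r k - r (k + 1))) := by
      rw [mul_sub, ← pow_add, mul_one]; congr 2; omega
    rw [h2, h3, inv_pow_sub_inv_pow hq0 (by omega), pair_add_left, pair_add_right,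
      pair_add_right, pair_single_left, pair_single_right, pair_single_left,
      Finsupp.single_eq_same, h4]
    simp only [pow_add, mul_one, one_mul, pow_one, inv_pow]
    field_simp
    linear_combination g (r + single (k + 1) 1) * h1
  · intro r hr h
    have : r k = r (k + 1) := by
      by_contra hc
      have h1 := hr (Nat.le_succ k)
      refine h (antitone_add_single hr ?_)
      rintro j hj
      obtain rfl : j = k := by omega
      simp only [Nat.succ_eq_add_one] at h1
      omega
    simp [this]

/-- Removing the first `k + 1` rows' leading boxes. -/
theorem weightedSum_ones (hq : ∀ n, q ^ (n + 1) ≠ 1) (n k : ℕ)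
    (g : (ℕ →₀ ℕ) → K) :
    weightedSum q (n + (k + 1)) (fun r => g r * (1 - q ^ (r k - r (k + 1)))) =
      weightedSum q n (fun r => g (r + ones (k + 1)) *
        q ^ (2 * pair r (ones (k + 1)) + (k + 1))) := by
  have := weightedSum_shift (q := q) (n := n) (e := ones (k + 1))
    (g := fun r => g r * (1 - q ^ (r k - r (k + 1))))
    (h := fun r => g (r + ones (k + 1)) * q ^ (2 * pair r (ones (k + 1)) + (k + 1)))
  rw [degree_ones] at this
  apply this
  · intro r hr hs
    have h01 : r (k + 1) ≤ r k := hr (Nat.le_succ _)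
    rcases h01.lt_or_eq with h | h
    · obtain ⟨s, hs1, hs2⟩ := exists_eq_add_ones hr h
      exact absurd hs2 (hs s hs1)
    · simp [h]
  · intro r hr _
    have h1 := invFactorials_add_ones hq hr k
    have h2 : (r + ones (k + 1) : ℕ →₀ ℕ) k - (r + ones (k + 1) : ℕ →₀ ℕ) (k + 1)
        = r k + 1 - r (k + 1) := by simp [ones_apply]
    rw [h2, ← h1, pair_add_left, pair_add_right, pair_add_right, pair_ones_ones,
      pair_comm (ones (k + 1)) r]
    ring
  · intro r hr h
    exact absurd (hr.add (antitone_ones _)) h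

end Weight

end Partition

namespace PowerSeries

/-- The coefficients of a power series, extended by zero to negative exponents. -/
noncomputable def zcoeff {A : Type*} [CommRing A] (a : ℤ) : PowerSeries A →ₗ[A] A :=
  if 0 ≤ a then coeff a.toNat else 0

variable {A : Type*} [CommRing A]

theorem zcoeff_natCast (n : ℕ) (g : PowerSeries A) : zcoeff n g = coeff n g := by
  simp [zcoeff]

theorem zcoeff_of_neg {a : ℤ} (h : a < 0) (g : PowerSeries A) : zcoeff a g = 0 := by
  simp [zcoeff, not_le.2 h]

theorem zcoeff_X_pow_mul (a : ℤ) (k : ℕ) (g : PowerSeries A) :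
    zcoeff a (X ^ k * g) = zcoeff (a - k) g := by
  rcases lt_or_ge a 0 with h | h
  · rw [zcoeff_of_neg h, zcoeff_of_neg (by omega)]
  · lift a to ℕ using h
    rw [zcoeff_natCast, coeff_X_pow_mul']
    split_ifs with hk
    · rw [← Nat.cast_sub hk, zcoeff_natCast]
    · rw [zcoeff_of_neg (by omega)]

theorem zcoeff_C_mul (a : ℤ) (c : A) (g : PowerSeries A) :
    zcoeff a (C c * g) = c * zcoeff a g := by
  rw [← smul_eq_C_mul, map_smul, smul_eq_mul]

/-- The power series `g` is a polynomial, palindromic with respect to the degree `N`. -/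
def Palindromic (N : ℕ) (g : PowerSeries A) : Prop := ∀ a : ℤ, zcoeff (N - a) g = zcoeff a g

namespace Palindromic

variable {N : ℕ} {g h : PowerSeries A}

theorem one : Palindromic 0 (1 : PowerSeries A) := by
  have key (a : ℤ) : zcoeff a (1 : PowerSeries A) = if a = 0 then 1 else 0 := by
    rcases lt_or_ge a 0 with h | h
    · rw [zcoeff_of_neg h, if_neg h.ne]
    · lift a to ℕ using h
      simp [zcoeff_natCast, coeff_one]
  intro a
  simp [key]

theorem add (hg : Palindromic N g) (hh : Palindromic N h) : Palindromic N (g + h) := fun a => by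
  rw [map_add, map_add, hg, hh]

theorem sub (hg : Palindromic N g) (hh : Palindromic N h) : Palindromic N (g - h) := fun a => by
  rw [map_sub, map_sub, hg, hh]

theorem C_mul (hg : Palindromic N g) (c : A) : Palindromic N (C c * g) := fun a => by
  rw [zcoeff_C_mul, zcoeff_C_mul, hg]

theorem zero : Palindromic N (0 : PowerSeries A) := fun a => by simp

theorem sum {ι : Type*} {s : Finset ι} {f : ι → PowerSeries A}
    (hf : ∀ i ∈ s, Palindromic N (f i)) : Palindromic N (∑ i ∈ s, f i) := fun a => by
  rw [map_sum, map_sum]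
  exact Finset.sum_congr rfl fun i hi => hf i hi a

theorem X_pow_mul (hg : Palindromic N g) (k : ℕ) : Palindromic (N + 2 * k) (X ^ k * g) :=
  fun a => by
  rw [zcoeff_X_pow_mul, zcoeff_X_pow_mul, ← hg]
  congr 2
  push_cast
  ring

theorem one_add_X_mul (hg : Palindromic N g) : Palindromic (N + 1) ((1 + X) * g) := fun a => by
  have (a : ℤ) : zcoeff a ((1 + X) * g) = zcoeff a g + zcoeff (a - 1) g := by
    rw [add_mul, one_mul, map_add, ← pow_one X, zcoeff_X_pow_mul, Nat.cast_one]
  rw [this, this, add_comm, ← hg a, ← hg (a - 1)]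
  congr 3 <;> push_cast <;> ring

end Palindromic

end PowerSeries

namespace Partition

open Finset Finsupp

variable {K : Type*} [Field K] (q : K)

/-- The generating series of the weighted sums of `r ↦ q⁻¹ ^ (∑ₜ r t * m t)`. -/
noncomputable def genSeries (m : ℕ →₀ ℕ) : PowerSeries K :=
  PowerSeries.mk fun n => weightedSum q n fun r => q⁻¹ ^ pair r m

theorem coeff_zero_genSeries (m : ℕ →₀ ℕ) : PowerSeries.coeff 0 (genSeries q m) = 1 := by
  simp [genSeries, weightedSum, partitions_zero, pair_zero_left, invFactorials]

/-- The weighted sum of `q⁻¹ ^ (∑ₜ r t * m t) * q ^ r (k - 1)`, which is zero for `k = 0`. -/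
noncomputable def boxSum (m : ℕ →₀ ℕ) (n : ℕ) : ℕ → K
  | 0 => 0
  | k + 1 => weightedSum q n fun r => q⁻¹ ^ pair r m * q ^ r k

variable {q}

theorem boxSum_of_lt {m : ℕ →₀ ℕ} {n k : ℕ} (h : n < k) :
    boxSum q m n k = weightedSum q n fun r => q⁻¹ ^ pair r m := by
  obtain ⟨k, rfl⟩ : ∃ l, k = l + 1 := ⟨k - 1, by omega⟩
  refine weightedSum_congr fun r hr hd => ?_
  rw [eq_zero_of_degree_le hr (t := k) (by omega), pow_zero, mul_one]

theorem pow_mul_weightedSum_sub (hq0 : q ≠ 0) (hq : ∀ n, q ^ (n + 1) ≠ 1) (m : ℕ →₀ ℕ) (n k : ℕ) :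
    q ^ m k * weightedSum q (n + 1) (fun r => q⁻¹ ^ pair r m * (q⁻¹ ^ r k - q⁻¹ ^ r (k + 1))) =
      boxSum q m n (k + 1) - boxSum q m n k := by
  have hm (k : ℕ) (r : ℕ →₀ ℕ) :
      q ^ m k * q⁻¹ ^ pair (r + single k 1) m = q⁻¹ ^ pair r m := by
    rw [pair_add_left, pair_single_left, pow_add, one_mul, inv_pow, inv_pow]
    field_simp
  cases k with
  | zero =>
    rw [weightedSum_single_zero hq0 hq, ← weightedSum_const_mul]
    simp only [boxSum, sub_zero, ← mul_assoc, hm]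
  | succ k =>
    rw [weightedSum_single_succ hq0 hq, ← weightedSum_const_mul]
    simp only [boxSum, ← mul_assoc, hm, mul_sub, weightedSum_sub]

theorem abel_summation (a p : ℕ → K) (N : ℕ) :
    a 0 * p 0 + ∑ k ∈ range N, (a (k + 1) - a k) * p (k + 1) =
      a N * p N + ∑ k ∈ range N, a k * (p k - p (k + 1)) := by
  induction N with
  | zero => simp
  | succ N ih => rw [sum_range_succ, sum_range_succ, ← add_assoc, ih]; ring

/-- The Pieri rule for the generating series. -/
theorem one_add_X_mul_genSeries (hq0 : q ≠ 0) (hq : ∀ n, q ^ (n + 1) ≠ 1) {m : ℕ →₀ ℕ} {N : ℕ}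
    (hN : ∀ k, N ≤ k → m k = 0) :
    (1 + PowerSeries.X) * genSeries q m = PowerSeries.C (q ^ m 0) * genSeries q (m + single 0 1) +
      ∑ k ∈ range N,
        PowerSeries.C (q ^ m (k + 1) - q ^ m k) * genSeries q (m + single (k + 1) 1) := by
  ext n
  rw [add_mul, one_mul, map_add, map_add, map_sum]
  simp only [PowerSeries.coeff_C_mul]
  cases n with
  | zero =>
    simp only [coeff_zero_genSeries, PowerSeries.coeff_zero_X_mul, mul_one]
    rw [sum_range_sub (fun k => q ^ m k), hN N le_rfl]
    simp
  | succ n =>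
    rw [PowerSeries.coeff_succ_X_mul]
    simp only [genSeries, PowerSeries.coeff_mk]
    have hsub : range N ⊆ range (N + n + 1) := range_subset_range.2 (by omega)
    rw [sum_subset hsub]
    swap
    · intro k _ hk
      have : N ≤ k := by simpa using hk
      rw [hN k this, hN (k + 1) (by omega), sub_self, zero_mul]
    have hp (k : ℕ) : (fun r => q⁻¹ ^ pair r (m + single k 1)) =
        fun r : ℕ →₀ ℕ => q⁻¹ ^ pair r m * q⁻¹ ^ r k := by
      ext r
      rw [pair_add_right, pair_single_right, mul_one, pow_add]
    simp only [hp]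
    have hc (c : K) (k : ℕ) : c * weightedSum q (n + 1) (fun r => q⁻¹ ^ pair r m * q⁻¹ ^ r k) =
        weightedSum q (n + 1) (fun r => q⁻¹ ^ pair r m * (c * q⁻¹ ^ r k)) := by
      rw [← weightedSum_const_mul]
      exact weightedSum_congr fun r _ _ => by ring
    simp only [hc]
    rw [← weightedSum_sum, ← weightedSum_add]
    simp only [← Finset.mul_sum, ← mul_add]
    have h1 (r : ℕ →₀ ℕ) := abel_summation (fun k => q ^ m k) (fun k => q⁻¹ ^ r k) (N + n + 1)
    simp only [h1, mul_add, weightedSum_add]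
    congr 1
    · refine weightedSum_congr fun r hr hd => ?_
      rw [hN _ (by omega), eq_zero_of_degree_le hr (t := N + n + 1) (by omega)]
      simp
    · simp only [Finset.mul_sum, weightedSum_sum]
      rw [← boxSum_of_lt (show n < N + n + 1 by omega), ← sub_zero (boxSum q m n _)]
      rw [show (0 : K) = boxSum q m n 0 from rfl, ← sum_range_sub]
      refine sum_congr rfl fun k _ => ?_
      rw [← pow_mul_weightedSum_sub hq0 hq, ← weightedSum_const_mul]
      exact weightedSum_congr fun r _ _ => by ring

/-- Moving a box from row `k` to row `k + 1`. -/
theorem exists_genSeries_eq (hq0 : q ≠ 0) (hq : ∀ n, q ^ (n + 1) ≠ 1) {m m' μ : ℕ →₀ ℕ} {k : ℕ}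
    (hm : m = μ + ones (k + 1) + ones (k + 1)) (hm' : m' + single k 1 = m + single (k + 1) 1) :
    ∃ c : K, genSeries q m' - genSeries q m =
      PowerSeries.C c * (PowerSeries.X ^ (k + 1) * genSeries q μ) := by
  have key (r : ℕ →₀ ℕ) (hr : Antitone r) : q⁻¹ ^ pair r m' =
      q⁻¹ ^ pair r m - q⁻¹ ^ pair r m * (1 - q ^ (r k - r (k + 1))) := by
    have h1 : pair r m' + r k = pair r m + r (k + 1) := by
      simpa [pair_add_right, pair_single_right] using congrArg (pair r) hm'
    have h2 : r (k + 1) ≤ r k := hr (Nat.le_succ k)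
    have h3 : pair r m = pair r m' + (r k - r (k + 1)) := by omega
    rw [h3, pow_add, inv_pow, inv_pow]
    field_simp
    ring
  refine ⟨-(q⁻¹ ^ pair (ones (k + 1)) m * q ^ (k + 1)), ?_⟩
  ext n
  rw [PowerSeries.coeff_C_mul, PowerSeries.coeff_X_pow_mul']
  have h4 : PowerSeries.coeff n (genSeries q m' - genSeries q m) =
      - weightedSum q n (fun r => q⁻¹ ^ pair r m * (1 - q ^ (r k - r (k + 1)))) := by
    rw [map_sub]
    simp only [genSeries, PowerSeries.coeff_mk]
    rw [weightedSum_congr fun r hr _ => key r hr, weightedSum_sub]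
    ring
  rw [h4]
  split_ifs with hn
  · obtain ⟨n, rfl⟩ := Nat.exists_eq_add_of_le' hn
    rw [weightedSum_ones hq, Nat.add_sub_cancel]
    simp only [genSeries, PowerSeries.coeff_mk]
    rw [neg_mul, ← weightedSum_const_mul]
    congr 1
    refine weightedSum_congr fun r _ _ => ?_
    have h5 : pair r m = pair r μ + 2 * pair r (ones (k + 1)) := by
      rw [hm, pair_add_right, pair_add_right]; ring
    rw [pair_add_left, h5, pow_add, pow_add, pow_add, inv_pow, inv_pow, inv_pow, pow_add]
    field_simp
  · rw [mul_zero, neg_eq_zero]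
    rw [weightedSum_congr (h := fun _ => 0)]
    · simp [weightedSum]
    · intro r hr hd
      rw [eq_zero_of_degree_le hr (t := k) (by omega)]
      simp

theorem coeff_genSeries_ones (hq0 : q ≠ 0) (hq : ∀ n, q ^ (n + 1) ≠ 1) (n k : ℕ) :
    PowerSeries.coeff (n + 1) (genSeries q (ones (k + 1))) =
      PowerSeries.coeff (n + 1) (genSeries q 0) + PowerSeries.coeff n (genSeries q (ones k)) := by
  have step (k : ℕ) : PowerSeries.coeff (n + 1) (genSeries q (ones (k + 1))) -
      PowerSeries.coeff (n + 1) (genSeries q (ones k)) =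
      PowerSeries.coeff n (genSeries q (ones k)) - boxSum q (ones k) n k := by
    simp only [genSeries, PowerSeries.coeff_mk]
    rw [← weightedSum_sub, ← boxSum_of_lt (show n < k + (n + 1) by omega)]
    have h1 := sum_range_sub (fun j => boxSum q (ones k) n (k + j)) (n + 1)
    simp only [add_zero] at h1
    rw [← h1]
    have h2 (j : ℕ) : boxSum q (ones k) n (k + (j + 1)) - boxSum q (ones k) n (k + j) =
        weightedSum q (n + 1) (fun r => q⁻¹ ^ pair r (ones k) *
          (q⁻¹ ^ r (k + j) - q⁻¹ ^ r (k + (j + 1)))) := by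
      have := pow_mul_weightedSum_sub hq0 hq (ones k) n (k + j)
      simp only [ones_apply, add_lt_iff_neg_left, not_lt_zero, if_false, pow_zero, one_mul] at this
      exact this.symm
    simp only [h2]
    rw [← weightedSum_sum]
    refine weightedSum_congr fun r hr hd => ?_
    rw [← Finset.mul_sum]
    have h3 := sum_range_sub' (fun j => q⁻¹ ^ r (k + j)) (n + 1)
    rw [h3, eq_zero_of_degree_le hr (t := k + (n + 1)) (by omega), ones_succ, pair_add_right,
      pair_single_right]
    simp only [mul_one, pow_add, add_zero, pow_zero]
    ring
  induction k with
  | zero =>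
    have := step 0
    rw [ones_zero] at this ⊢
    simp only [boxSum] at this
    linear_combination this
  | succ k ih =>
    have := step (k + 1)
    have h : boxSum q (ones (k + 1)) n (k + 1) =
        PowerSeries.coeff n (genSeries q (ones k)) := by
      simp only [boxSum, genSeries, PowerSeries.coeff_mk]
      refine weightedSum_congr fun r _ _ => ?_
      rw [ones_succ, pair_add_right, pair_single_right, mul_one, pow_add, inv_pow, inv_pow]
      field_simp
    rw [h] at this
    linear_combination this + ih

theorem coeff_genSeries_ones_of_le {n k : ℕ} (h : n ≤ k) :
    PowerSeries.coeff n (genSeries q (ones k)) =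
      q⁻¹ ^ n * PowerSeries.coeff n (genSeries q 0) := by
  simp only [genSeries, PowerSeries.coeff_mk]
  rw [← weightedSum_const_mul]
  refine weightedSum_congr fun r hr hd => ?_
  rw [pair_zero_right, pow_zero, mul_one, pair_ones_right, ← hd, degree_apply]
  congr 1
  refine (sum_subset (fun t ht => ?_) fun t _ ht => ?_).symm
  · by_contra hc
    exact (mem_support_iff.1 ht) (eq_zero_of_degree_le hr (by simp at hc; omega))
  · simpa using ht

theorem qFactorial_ne_zero (hq : ∀ n, q ^ (n + 1) ≠ 1) (n : ℕ) : qFactorial q n ≠ 0 :=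
  prod_ne_zero_iff.2 fun _ _ => sub_ne_zero.2 (hq _).symm

theorem coeff_genSeries_zero (hq0 : q ≠ 0) (hq : ∀ n, q ^ (n + 1) ≠ 1) (n : ℕ) :
    PowerSeries.coeff n (genSeries q 0) = q ^ n * (qFactorial q n)⁻¹ := by
  induction n with
  | zero => simp [coeff_zero_genSeries, qFactorial]
  | succ n ih =>
    have h := coeff_genSeries_ones hq0 hq n n
    rw [coeff_genSeries_ones_of_le le_rfl, coeff_genSeries_ones_of_le le_rfl, ih] at h
    have h1 := sub_ne_zero.2 (hq n).symm
    have h2 := qFactorial_ne_zero hq n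
    rw [qFactorial_succ]
    rw [inv_pow, inv_pow] at h
    field_simp at h ⊢
    rw [pow_succ] at *
    linear_combination h

/-- The generating series relative to the one for `m = 0` is a palindromic polynomial. -/
theorem palindromic_genSeries (hq0 : q ≠ 0) (hq : ∀ n, q ^ (n + 1) ≠ 1) {m : ℕ →₀ ℕ}
    (hm : Antitone m) :
    PowerSeries.Palindromic m.degree (genSeries q m * (genSeries q 0)⁻¹) := by
  induction hD : m.degree using Nat.strong_induction_on generalizing m with
  | _ D ihD =>
  induction hM : (m.sum fun k x => x * k) using Nat.strong_induction_on generalizing m with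
  | _ M ihM =>
  rcases eq_or_ne m 0 with rfl | hm0
  · rw [PowerSeries.mul_inv_cancel]
    · rw [← hD, map_zero]
      exact .one
    · rw [← PowerSeries.coeff_zero_eq_constantCoeff, coeff_zero_genSeries]
      exact one_ne_zero
  obtain ⟨L, hL, hL1⟩ : ∃ L, m L ≠ 0 ∧ m (L + 1) = 0 := by
    classical
    have hex : ∃ t, m t = 0 := ⟨_, eq_zero_of_degree_le hm le_rfl⟩
    obtain ⟨L, hL⟩ : ∃ L, Nat.find hex = L + 1 := by
      refine Nat.exists_eq_succ_of_ne_zero fun h => hm0 ?_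
      have h0 := Nat.find_spec hex
      rw [h] at h0
      ext t
      simpa [h0] using hm (Nat.zero_le t)
    exact ⟨L, Nat.find_min hex (by omega), hL ▸ Nat.find_spec hex⟩
  obtain ⟨s, hs, rfl⟩ := exists_eq_add_single hm (k := L) (by omega)
  have hsN (k : ℕ) (hk : L + 1 ≤ k) : s k = 0 := by
    have := hm hk
    rw [hL1] at this
    simp at this
    exact this.1
  have hsD : s.degree + 1 = D := by rw [← hD, map_add, degree_single]
  have hmom (k : ℕ) : ((s + single k 1).sum fun k x => x * k) = (s.sum fun k x => x * k) + k := by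
    rw [Finsupp.sum_add_index' (by simp) (by intros; ring)]
    simp
  set e := (genSeries q 0)⁻¹ with he
  have hpal (k : ℕ) (hk : k < L) (ha : Antitone (s + single k 1 : ℕ →₀ ℕ)) :
      PowerSeries.Palindromic D (genSeries q (s + single k 1) * e) := by
    refine ihM _ ?_ ha ?_ rfl
    · rw [← hM, hmom, hmom]; omega
    · rw [map_add, degree_single, hsD]
  have hpieri := one_add_X_mul_genSeries hq0 hq hsN
  have hs1 : PowerSeries.Palindromic D ((1 + PowerSeries.X) * (genSeries q s * e)) := by
    rw [← hsD]
    exact (ihD s.degree (by omega) hs rfl).one_add_X_mul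
  have hlast : PowerSeries.Palindromic D (PowerSeries.C (1 - q ^ s L) *
      ((genSeries q (s + single (L + 1) 1) - genSeries q (s + single L 1)) * e)) := by
    rcases Nat.eq_zero_or_pos (s L) with h0 | h0
    · simp only [h0, pow_zero, sub_self, map_zero, zero_mul]
      exact .zero
    · refine PowerSeries.Palindromic.C_mul ?_ _
      obtain ⟨r, hr, hr'⟩ := exists_eq_add_ones hm (k := L) (by omega)
      have h1 : (s + single L 1 : ℕ →₀ ℕ) L = (r + ones (L + 1) : ℕ →₀ ℕ) L := by rw [hr']
      have h2 : (s + single L 1 : ℕ →₀ ℕ) (L + 1) = (r + ones (L + 1) : ℕ →₀ ℕ) (L + 1) := by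
        rw [hr']
      have h3 : s (L + 1) = 0 := hsN _ le_rfl
      simp [ones_apply] at h1 h2
      obtain ⟨μ, hμ, rfl⟩ := exists_eq_add_ones hr (k := L) (by omega)
      obtain ⟨c, hc⟩ := exists_genSeries_eq hq0 hq (m' := s + single (L + 1) 1) hr' (by abel)
      rw [hc, mul_assoc, mul_assoc]
      have h4 : D = μ.degree + 2 * (L + 1) := by
        rw [← hD, hr', map_add, map_add, degree_ones]; ring
      rw [h4]
      exact ((ihD μ.degree (by omega) hμ rfl).X_pow_mul _).C_mul _
  cases L with
  | zero =>
    rw [sum_range_one, hsN 1 le_rfl, pow_zero] at hpieri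
    convert hs1.sub hlast using 1
    rw [← mul_assoc, hpieri]
    simp only [map_sub, map_one]
    ring
  | succ L =>
    rw [sum_range_succ, sum_range_succ, hsN (L + 1 + 1) le_rfl, pow_zero] at hpieri
    have hL' : q ^ s L ≠ 1 := by
      have h1 : (s + single (L + 1) 1 : ℕ →₀ ℕ) (L + 1) ≤ (s + single (L + 1) 1 : ℕ →₀ ℕ) L :=
        hm (Nat.le_succ L)
      simp at h1
      obtain ⟨j, hj⟩ : ∃ j, s L = j + 1 := ⟨s L - 1, by omega⟩
      rw [hj]
      exact hq j
    have hrest : PowerSeries.Palindromic D (PowerSeries.C (q ^ s 0) * (genSeries q (s + single 0 1) * e)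
        + ∑ k ∈ range L, PowerSeries.C (q ^ s (k + 1) - q ^ s k) *
          (genSeries q (s + single (k + 1) 1) * e)) := by
      refine .add (.C_mul (hpal 0 (by omega) (antitone_add_single hs (by simp))) _)
        (.sum fun k hk => ?_)
      rw [mem_range] at hk
      rcases eq_or_ne (s (k + 1)) (s k) with h | h
      · rw [h, sub_self, map_zero, zero_mul]
        exact .zero
      · refine .C_mul (hpal (k + 1) (by omega) (antitone_add_single hs ?_)) _
        intro j hj
        obtain rfl : j = k := by omega
        exact lt_of_le_of_ne (hs (Nat.le_succ j)) h
    have key : genSeries q (s + single (L + 1) 1) * e = PowerSeries.C (1 - q ^ s L)⁻¹ *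
        ((1 + PowerSeries.X) * (genSeries q s * e) - (PowerSeries.C (q ^ s 0) *
          (genSeries q (s + single 0 1) * e)
        + ∑ k ∈ range L, PowerSeries.C (q ^ s (k + 1) - q ^ s k) *
          (genSeries q (s + single (k + 1) 1) * e)) - PowerSeries.C (1 - q ^ s (L + 1)) *
      ((genSeries q (s + single (L + 1 + 1) 1) - genSeries q (s + single (L + 1) 1)) * e)) := by
      have h1 : PowerSeries.C (1 - q ^ s L)⁻¹ * PowerSeries.C (1 - q ^ s L) = 1 := by
        rw [← map_mul, inv_mul_cancel₀ (sub_ne_zero.2 hL'.symm), map_one]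
      rw [← mul_assoc (1 + PowerSeries.X), hpieri]
      simp only [← mul_assoc _ _ e, ← Finset.sum_mul]
      simp only [map_sub, map_one] at h1 ⊢
      linear_combination (- genSeries q (s + single (L + 1) 1) * e) * h1
    rw [key]
    exact ((hs1.sub hrest).sub hlast).C_mul _

end Partition

namespace MvPowerSeries

section

variable {ι A : Type*} [CommRing A]

/-- The exponent of a monomial, as an integer vector. -/
def intExp (d : ι →₀ ℕ) : ι → ℤ := fun i => d i

theorem intExp_injective : Function.Injective (intExp (ι := ι)) := fun d d' h => by
  ext i
  exact Int.ofNat_inj.1 (congrFun h i)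

theorem nsmul_exp_injective {c : ι →₀ ℕ} (hc : c ≠ 0) : Function.Injective fun n : ℕ => n • c := by
  intro n k h
  obtain ⟨i, hi⟩ := Finsupp.ne_iff.1 hc
  have := DFunLike.congr_fun h i
  simp only [Finsupp.smul_apply, smul_eq_mul] at this
  exact Nat.eq_of_mul_eq_mul_right (Nat.pos_of_ne_zero hi) this

theorem intExp_nsmul (n : ℕ) (c : ι →₀ ℕ) : intExp (n • c) = n • intExp c := by
  ext i
  simp [intExp]

/-- The substitution of the monomial with exponent `c` in a power series in one variable. -/
noncomputable def substMonomial (c : ι →₀ ℕ) (g : PowerSeries A) : MvPowerSeries ι A :=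
  PowerSeries.subst (monomial c (1 : A)) g

theorem coeff_substMonomial [DecidableEq ι] {c : ι →₀ ℕ} (hc : c ≠ 0) (g : PowerSeries A)
    (d : ι →₀ ℕ) :
    coeff d (substMonomial c g) = ∑ᶠ n : ℕ, if d = n • c then PowerSeries.coeff n g else 0 := by
  classical
  rw [substMonomial, PowerSeries.coeff_subst (PowerSeries.HasSubst.monomial hc _)]
  refine finsum_congr fun n => ?_
  rw [monomial_pow, one_pow, coeff_monomial]
  simp

theorem coeff_smul_substMonomial {c : ι →₀ ℕ} (hc : c ≠ 0) (g : PowerSeries A) (n : ℕ) :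
    coeff (n • c) (substMonomial c g) = PowerSeries.coeff n g := by
  classical
  rw [coeff_substMonomial hc, finsum_eq_single _ n, if_pos rfl]
  intro k hk
  exact if_neg fun h => hk (nsmul_exp_injective hc h).symm

theorem coeff_substMonomial_eq_zero {c : ι →₀ ℕ} (hc : c ≠ 0) (g : PowerSeries A) {d : ι →₀ ℕ}
    (hd : ∀ n : ℕ, d ≠ n • c) : coeff d (substMonomial c g) = 0 := by
  classical
  rw [coeff_substMonomial hc]
  exact finsum_eq_zero_of_forall_eq_zero fun n => if_neg (hd n)

theorem constantCoeff_substMonomial {c : ι →₀ ℕ} (hc : c ≠ 0) (g : PowerSeries A) :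
    constantCoeff (substMonomial c g) = PowerSeries.constantCoeff g := by
  have := coeff_smul_substMonomial hc g 0
  simpa using this

theorem substMonomial_mul {c : ι →₀ ℕ} (hc : c ≠ 0) (g h : PowerSeries A) :
    substMonomial c (g * h) = substMonomial c g * substMonomial c h :=
  PowerSeries.subst_mul (PowerSeries.HasSubst.monomial hc _) g h

theorem substMonomial_one {c : ι →₀ ℕ} (hc : c ≠ 0) :
    substMonomial c (1 : PowerSeries A) = 1 := by
  have := map_one (PowerSeries.substAlgHom (R := A) (PowerSeries.HasSubst.monomial hc (1 : A)))
  rwa [PowerSeries.coe_substAlgHom] at this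

end

variable {ι : Type*} [Fintype ι] {A : Type*} [CommRing A]

theorem exists_intExp_eq {v : ι → ℤ} (h : 0 ≤ v) : ∃ d : ι →₀ ℕ, intExp d = v :=
  ⟨Finsupp.equivFunOnFinite.symm fun i => (v i).toNat, funext fun i => by
    simpa [intExp] using h i⟩

open Classical in
/-- The coefficients of a power series, extended by zero to all integer exponents. -/
noncomputable def zcoeff (v : ι → ℤ) (g : MvPowerSeries ι A) : A :=
  if 0 ≤ v then coeff (Finsupp.equivFunOnFinite.symm fun i => (v i).toNat) g else 0

theorem zcoeff_intExp (d : ι →₀ ℕ) (g : MvPowerSeries ι A) : zcoeff (intExp d) g = coeff d g := by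
  rw [zcoeff, if_pos (show 0 ≤ intExp d from fun i => by simp [intExp])]
  congr 2
  ext i
  simp [intExp]

theorem zcoeff_of_not_nonneg {v : ι → ℤ} (h : ¬ 0 ≤ v) (g : MvPowerSeries ι A) :
    zcoeff v g = 0 := if_neg h

theorem zcoeff_mul (v : ι → ℤ) (f g : MvPowerSeries ι A) :
    zcoeff v (f * g) = ∑ᶠ a, zcoeff a f * zcoeff (v - a) g := by
  classical
  by_cases hv : 0 ≤ v
  · obtain ⟨d, rfl⟩ := exists_intExp_eq hv
    rw [zcoeff_intExp, coeff_mul, finsum_eq_sum_of_support_subset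
      (s := (Finset.HasAntidiagonal.antidiagonal d).image fun p => intExp p.1), Finset.sum_image]
    · refine Finset.sum_congr rfl fun p hp => ?_
      rw [zcoeff_intExp, ← Finset.HasAntidiagonal.mem_antidiagonal.1 hp]
      have : intExp (p.1 + p.2) - intExp p.1 = intExp p.2 := by
        ext i; simp [intExp]
      rw [this, zcoeff_intExp]
    · intro p hp p' hp' h
      have h1 := intExp_injective h
      have h2 := (Finset.HasAntidiagonal.mem_antidiagonal.1 hp).trans (Finset.HasAntidiagonal.mem_antidiagonal.1 hp').symm
      rw [h1] at h2
      exact Prod.ext h1 (add_left_cancel h2)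
    · intro a ha
      have h1 : 0 ≤ a := by
        by_contra hc
        exact ha (by simp [zcoeff_of_not_nonneg hc])
      have h2 : 0 ≤ intExp d - a := by
        by_contra hc
        exact ha (by simp [zcoeff_of_not_nonneg hc])
      obtain ⟨a, rfl⟩ := exists_intExp_eq h1
      obtain ⟨b, hb⟩ := exists_intExp_eq h2
      simp only [Finset.coe_image, Set.mem_image, Finset.mem_coe, Finset.HasAntidiagonal.mem_antidiagonal]
      refine ⟨(a, b), intExp_injective ?_, rfl⟩
      ext i
      have := congrFun hb i
      simp [intExp] at *
      omega
  · rw [zcoeff_of_not_nonneg hv]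
    symm
    refine finsum_eq_zero_of_forall_eq_zero fun a => ?_
    by_cases h1 : 0 ≤ a
    · rw [zcoeff_of_not_nonneg (v := v - a), mul_zero]
      intro h2
      exact hv (h1.trans (sub_nonneg.1 h2))
    · rw [zcoeff_of_not_nonneg h1, zero_mul]

/-- The power series `f` and `g` correspond to each other under the transformation `s`
of the exponents. -/
def Corresponds (s : (ι → ℤ) ≃+ (ι → ℤ)) (f g : MvPowerSeries ι A) : Prop :=
  ∀ v, zcoeff (s v) g = zcoeff v f

namespace Corresponds

variable {s : (ι → ℤ) ≃+ (ι → ℤ)} {f g f' g' : MvPowerSeries ι A}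

theorem mul (h : Corresponds s f g) (h' : Corresponds s f' g') :
    Corresponds s (f * f') (g * g') := fun v => by
  rw [zcoeff_mul, zcoeff_mul, ← finsum_comp_equiv s.toEquiv]
  refine finsum_congr fun a => ?_
  rw [← h a, ← h' (v - a), map_sub]
  rfl

theorem one : Corresponds s (1 : MvPowerSeries ι A) 1 := by
  classical
  have key (v : ι → ℤ) : zcoeff v (1 : MvPowerSeries ι A) = if v = 0 then 1 else 0 := by
    by_cases h : 0 ≤ v
    · obtain ⟨d, rfl⟩ := exists_intExp_eq h
      rw [zcoeff_intExp, coeff_one]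
      congr 1
      rw [eq_iff_iff, ← intExp_injective.eq_iff]
      rfl
    · rw [zcoeff_of_not_nonneg h, if_neg fun h' => h h'.ge]
  intro v
  simp [key]

theorem prod {κ : Type*} {t : Finset κ} {F G : κ → MvPowerSeries ι A}
    (h : ∀ k ∈ t, Corresponds s (F k) (G k)) :
    Corresponds s (∏ k ∈ t, F k) (∏ k ∈ t, G k) := by
  classical
  induction t using Finset.induction_on with
  | empty => simpa using one
  | insert k t hk ih =>
    rw [Finset.prod_insert hk, Finset.prod_insert hk]
    exact (h k (by simp)).mul (ih fun k' hk' => h k' (by simp [hk']))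

end Corresponds

theorem corresponds_substMonomial {s : (ι → ℤ) ≃+ (ι → ℤ)} {c c' : ι →₀ ℕ} (hc : c ≠ 0)
    (hc' : c' ≠ 0) (h : intExp c' = s (intExp c)) (g : PowerSeries A) :
    Corresponds s (substMonomial c g) (substMonomial c' g) := by
  have key {c : ι →₀ ℕ} (hc : c ≠ 0) (v : ι → ℤ) :
      (∃ n : ℕ, v = n • intExp c ∧ zcoeff v (substMonomial c g) = PowerSeries.coeff n g) ∨
      ((∀ n : ℕ, v ≠ n • intExp c) ∧ zcoeff v (substMonomial c g) = 0) := by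
    by_cases h : ∃ n : ℕ, v = n • intExp c
    · obtain ⟨n, rfl⟩ := h
      refine .inl ⟨n, rfl, ?_⟩
      rw [← intExp_nsmul, zcoeff_intExp, coeff_smul_substMonomial hc]
    · push Not at h
      refine .inr ⟨h, ?_⟩
      by_cases hv : 0 ≤ v
      · obtain ⟨d, rfl⟩ := exists_intExp_eq hv
        rw [zcoeff_intExp, coeff_substMonomial_eq_zero hc]
        rintro n rfl
        exact h n (intExp_nsmul n c)
      · exact zcoeff_of_not_nonneg hv _
  intro v
  have hs (n : ℕ) : s v = n • intExp c' ↔ v = n • intExp c := by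
    rw [h, ← map_nsmul, s.injective.eq_iff]
  rcases key hc v with ⟨n, hn, h1⟩ | ⟨hn, h1⟩ <;> rcases key hc' (s v) with ⟨k, hk, h2⟩ | ⟨hk, h2⟩
  · rw [h1, h2]
    rw [hs, hn, ← intExp_nsmul, ← intExp_nsmul] at hk
    rw [nsmul_exp_injective hc (intExp_injective hk)]
  · exact absurd ((hs n).2 hn) (hk n)
  · exact absurd ((hs k).1 hk) (hn k)
  · rw [h1, h2]

end MvPowerSeries

namespace Partition

open Finset MvPowerSeries

section

variable {ι K : Type*} [DecidableEq ι] [Field K]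

/-- The one-variable series of coefficients at exponents `d + n • eᵢ`. -/
noncomputable def slice (i : ι) (d : ι →₀ ℕ) (g : MvPowerSeries ι K) : PowerSeries K :=
  PowerSeries.mk fun n => coeff (d + Finsupp.single i n) g

theorem slice_mul_substMonomial {i : ι} {d : ι →₀ ℕ} (hd : d i = 0) (F : MvPowerSeries ι K)
    (e : PowerSeries K) :
    slice i d (F * substMonomial (Finsupp.single i 1) e) = slice i d F * e := by
  have hne : (Finsupp.single i 1 : ι →₀ ℕ) ≠ 0 := by simp
  ext n
  rw [slice, PowerSeries.coeff_mk, coeff_mul, PowerSeries.coeff_mul]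
  symm
  refine sum_of_injOn (fun p => (d + Finsupp.single i p.1, Finsupp.single i p.2)) ?_ ?_ ?_ ?_
  · intro p _ p' _ h
    simp only [Prod.mk.injEq, add_right_inj] at h
    exact Prod.ext (Finsupp.single_injective i h.1) (Finsupp.single_injective i h.2)
  · intro p hp
    simp only [mem_coe, HasAntidiagonal.mem_antidiagonal] at hp ⊢
    rw [add_assoc, ← Finsupp.single_add, hp]
  · rintro ⟨a, b⟩ hab himg
    rw [HasAntidiagonal.mem_antidiagonal] at hab
    rw [coeff_substMonomial_eq_zero hne, mul_zero]
    rintro k rfl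
    apply himg
    have hk : k • Finsupp.single i 1 = (Finsupp.single i k : ι →₀ ℕ) := by simp
    simp only [hk] at hab ⊢
    have hi : a i + k = n := by simpa [hd] using DFunLike.congr_fun hab i
    refine ⟨(a i, k), by simpa using hi, ?_⟩
    simp only [Prod.mk.injEq, and_true]
    ext j
    have hj := DFunLike.congr_fun hab j
    rcases eq_or_ne j i with rfl | h
    · simp [hd]
    · simpa [h, h.symm] using hj.symm
  · intro p _
    have hk : (Finsupp.single i p.2 : ι →₀ ℕ) = p.2 • Finsupp.single i 1 := by simp
    simp only [slice, PowerSeries.coeff_mk]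
    rw [hk, coeff_smul_substMonomial hne]

end

variable {ι : Type*} [Fintype ι] [DecidableEq ι]

/-- The simple reflection attached to the vertex `i` of the graph with edge multiplicities `C`. -/
def reflection (C : ι → ι → ℕ) (hC : ∀ i, C i i = 0) (i : ι) : (ι → ℤ) ≃+ (ι → ℤ) where
  toFun v := Function.update v i (∑ j, C i j * v j - v i)
  invFun v := Function.update v i (∑ j, C i j * v j - v i)
  left_inv v := by
    have h (x : ℤ) : ∑ j, (C i j : ℤ) * Function.update v i x j = ∑ j, C i j * v j :=
      sum_congr rfl fun j _ => by
        rcases eq_or_ne j i with rfl | hj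
        · simp [hC]
        · simp [hj]
    ext k
    rcases eq_or_ne k i with rfl | hk
    · simp [h]
    · simp [hk]
  right_inv v := by
    have h (x : ℤ) : ∑ j, (C i j : ℤ) * Function.update v i x j = ∑ j, C i j * v j :=
      sum_congr rfl fun j _ => by
        rcases eq_or_ne j i with rfl | hj
        · simp [hC]
        · simp [hj]
    ext k
    rcases eq_or_ne k i with rfl | hk
    · simp [h]
    · simp [hk]
  map_add' v w := by
    ext k
    rcases eq_or_ne k i with rfl | hk
    · simp [mul_add, sum_add_distrib]; ring
    · simp [hk]

theorem reflection_apply_self (C : ι → ι → ℕ) (hC : ∀ i, C i i = 0) (i : ι) (v : ι → ℤ) :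
    reflection C hC i v i = ∑ j, C i j * v j - v i := by
  simp [reflection]

theorem reflection_apply_of_ne (C : ι → ι → ℕ) (hC : ∀ i, C i i = 0) {i j : ι} (hj : j ≠ i)
    (v : ι → ℤ) : reflection C hC i v j = v j := by
  simp [reflection, hj]

theorem reflection_reflection (C : ι → ι → ℕ) (hC : ∀ i, C i i = 0) (i : ι) (v : ι → ℤ) :
    reflection C hC i (reflection C hC i v) = v :=
  (reflection C hC i).left_inv v

variable {K : Type*} [Field K] (q : K) (N : ι → ι → ℕ)

/-- The summand of the multivariable partition sum attached to the graph with oriented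
edge multiplicities `N`. -/
noncomputable def graphWeight (r : ι → ℕ →₀ ℕ) : K :=
  (∏ j, (q ^ pair (r j) (r j) * invFactorials q (r j))) *
    q⁻¹ ^ ∑ a, ∑ b, N a b * pair (r a) (r b)

/-- The generating series of the multivariable partition sums attached to a graph. -/
noncomputable def graphSeries : MvPowerSeries ι K := fun d =>
  ∑ r ∈ Fintype.piFinset fun j => partitions (d j), graphWeight q N r

theorem coeff_graphSeries (d : ι →₀ ℕ) : coeff d (graphSeries q N) =
    ∑ r ∈ Fintype.piFinset fun j => partitions (d j), graphWeight q N r := rfl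

/-- The partitions dual to a multi-partition at the vertex `i`. -/
noncomputable def neighbours (i : ι) (r : ι → ℕ →₀ ℕ) : ℕ →₀ ℕ := ∑ j, (N i j + N j i) • r j

variable {N}

theorem pair_sum_right {κ : Type*} (s : Finset κ) (x : ℕ →₀ ℕ) (r : κ → ℕ →₀ ℕ) (c : κ → ℕ) :
    pair x (∑ j ∈ s, c j • r j) = ∑ j ∈ s, c j * pair x (r j) := by
  classical
  induction s using Finset.induction_on with
  | empty => simp [pair_zero_right]
  | insert j s hj ih =>
    have (n : ℕ) : pair x (n • r j) = n * pair x (r j) := by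
      induction n with
      | zero => simp [pair_zero_right]
      | succ n ih => rw [succ_nsmul, pair_add_right, ih]; ring
    rw [sum_insert hj, sum_insert hj, pair_add_right, ih, this]

theorem graphWeight_update (hN : ∀ i, N i i = 0) {i : ι} {r : ι → ℕ →₀ ℕ} (hr : r i = 0)
    (x : ℕ →₀ ℕ) :
    graphWeight q N (Function.update r i x) =
      graphWeight q N r * (q ^ pair x x * invFactorials q x * q⁻¹ ^ pair x (neighbours N i r)) := by
  have h1 : ∏ j, (q ^ pair (Function.update r i x j) (Function.update r i x j) *
      invFactorials q (Function.update r i x j)) =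
      (q ^ pair x x * invFactorials q x) * ∏ j, (q ^ pair (r j) (r j) * invFactorials q (r j)) := by
    rw [← Finset.mul_prod_erase _ _ (mem_univ i),
      ← Finset.mul_prod_erase univ (fun j => q ^ pair (r j) (r j) * _) (mem_univ i), hr]
    simp only [Function.update_self, pair_zero_left, pow_zero, one_mul]
    rw [show invFactorials q 0 = 1 by simp [invFactorials], one_mul]
    congr 1
    exact prod_congr rfl fun j hj => by rw [Function.update_of_ne (ne_of_mem_erase hj)]
  have hu (j : ι) : Function.update r i x j = r j + if j = i then x else 0 := by
    rcases eq_or_ne j i with rfl | hj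
    · simp [hr]
    · simp [hj]
  have hl (j : ι) (y : ℕ →₀ ℕ) : pair (if j = i then x else 0) y = if j = i then pair x y else 0 := by
    split_ifs <;> simp [pair_zero_left]
  have hr' (j : ι) (y : ℕ →₀ ℕ) : pair y (if j = i then x else 0) = if j = i then pair x y else 0 := by
    split_ifs <;> simp [pair_zero_right, pair_comm]
  have h2 : ∑ a, ∑ b, N a b * pair (Function.update r i x a) (Function.update r i x b) =
      ∑ a, ∑ b, N a b * pair (r a) (r b) + pair x (neighbours N i r) := by
    rw [neighbours, pair_sum_right]
    simp only [hu, pair_add_left, pair_add_right, hl, hr', mul_add, sum_add_distrib, add_mul,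
      mul_ite, mul_zero, sum_ite_eq', mem_univ, if_true]
    rw [sum_comm (f := fun a b => if a = i then N a b * pair x (r b) else 0)]
    simp [hN]
    ring
  rw [graphWeight, graphWeight, h1, h2, pow_add]
  ring

theorem antitone_sum {κ : Type*} {s : Finset κ} {f : κ → ℕ →₀ ℕ} (h : ∀ j ∈ s, Antitone (f j)) :
    Antitone (∑ j ∈ s, f j : ℕ →₀ ℕ) := by
  intro a b hab
  simp only [Finsupp.coe_finsetSum, Finset.sum_apply]
  exact sum_le_sum fun j hj => h j hj hab

theorem slice_graphSeries (hN : ∀ i, N i i = 0) {i : ι} {d : ι →₀ ℕ} (hd : d i = 0) :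
    slice i d (graphSeries q N) = ∑ r ∈ Fintype.piFinset fun j => partitions (d j),
      PowerSeries.C (graphWeight q N r) * genSeries q (neighbours N i r) := by
  ext n
  rw [slice, PowerSeries.coeff_mk, coeff_graphSeries, map_sum]
  simp only [PowerSeries.coeff_C_mul, genSeries, PowerSeries.coeff_mk, weightedSum, Finset.mul_sum]
  rw [sum_sigma']
  refine sum_bij' (fun r _ => ⟨Function.update r i 0, r i⟩)
    (fun p _ => Function.update p.1 i p.2) ?_ ?_ ?_ ?_ ?_
  · intro r hr
    rw [Fintype.mem_piFinset] at hr
    rw [mem_sigma, Fintype.mem_piFinset]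
    refine ⟨fun j => ?_, by simpa [hd] using hr i⟩
    rcases eq_or_ne j i with rfl | hj
    · simp [hd, partitions_zero]
    · simpa [hj, hj.symm] using hr j
  · rintro ⟨r, x⟩ hr
    rw [mem_sigma, Fintype.mem_piFinset] at hr
    rw [Fintype.mem_piFinset]
    intro j
    rcases eq_or_ne j i with rfl | hj
    · simpa [hd] using hr.2
    · simpa [hj, hj.symm] using hr.1 j
  · intro r _
    simp
  · rintro ⟨r, x⟩ hr
    rw [mem_sigma, Fintype.mem_piFinset] at hr
    have h0 : r i = 0 := by simpa [hd, partitions_zero] using hr.1 i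
    simp only [Function.update_idem, Function.update_self]
    rw [← h0, Function.update_eq_self]
  · intro r _
    have h := graphWeight_update q hN (i := i) (r := Function.update r i 0) (by simp) (r i)
    rw [Function.update_idem, Function.update_eq_self] at h
    rw [h]

theorem palindromic_slice (hq0 : q ≠ 0) (hq : ∀ n, q ^ (n + 1) ≠ 1) (hN : ∀ i, N i i = 0) {i : ι}
    {d : ι →₀ ℕ} (hd : d i = 0) :
    PowerSeries.Palindromic (∑ j, (N i j + N j i) * d j) (slice i d
      (graphSeries q N * substMonomial (Finsupp.single i 1) (genSeries q 0)⁻¹)) := by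
  rw [slice_mul_substMonomial hd, slice_graphSeries q hN hd, sum_mul]
  refine .sum fun r hr => ?_
  rw [Fintype.mem_piFinset] at hr
  rw [mul_assoc]
  refine .C_mul ?_ _
  have h1 : Antitone (neighbours N i r) := by
    refine antitone_sum fun j _ a b hab => ?_
    simp only [Finsupp.smul_apply, smul_eq_mul]
    exact Nat.mul_le_mul_left _ ((mem_partitions.1 (hr j)).1 hab)
  have h2 : (neighbours N i r).degree = ∑ j, (N i j + N j i) * d j := by
    rw [neighbours, map_sum]
    exact sum_congr rfl fun j _ => by
      rw [map_nsmul, (mem_partitions.1 (hr j)).2, smul_eq_mul]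
  rw [← h2]
  exact palindromic_genSeries hq0 hq h1

variable (C : ι → ι → ℕ) (hC : ∀ i, C i i = 0)

theorem corresponds_graphSeries_mul (hq0 : q ≠ 0) (hq : ∀ n, q ^ (n + 1) ≠ 1)
    (hCN : ∀ i j, C i j = N i j + N j i) (i : ι) :
    Corresponds (reflection C hC i)
      (graphSeries q N * substMonomial (Finsupp.single i 1) (genSeries q 0)⁻¹)
      (graphSeries q N * substMonomial (Finsupp.single i 1) (genSeries q 0)⁻¹) := by
  have hN (i : ι) : N i i = 0 := by
    have := hC i
    rw [hCN] at this
    omega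
  set G := graphSeries q N * substMonomial (Finsupp.single i 1) (genSeries q 0)⁻¹
  have key (v : ι → ℤ) (d : ι →₀ ℕ) (hd : d i = 0) (hv : ∀ j, j ≠ i → v j = d j) :
      MvPowerSeries.zcoeff v G = PowerSeries.zcoeff (v i) (slice i d G) := by
    by_cases h : 0 ≤ v i
    · lift v i to ℕ using h with n hn
      rw [PowerSeries.zcoeff_natCast, slice, PowerSeries.coeff_mk, ← zcoeff_intExp]
      congr 1
      ext j
      rcases eq_or_ne j i with rfl | hj
      · simp [intExp, hd, hn]
      · simp [intExp, hv j hj, hj]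
    · rw [PowerSeries.zcoeff_of_neg (not_le.1 h), zcoeff_of_not_nonneg fun h' => h (h' i)]
  intro v
  by_cases h : ∀ j, j ≠ i → 0 ≤ v j
  · let d : ι →₀ ℕ := Finsupp.equivFunOnFinite.symm fun j => if j = i then 0 else (v j).toNat
    have hd : d i = 0 := by simp [d]
    have hv (j : ι) (hj : j ≠ i) : v j = d j := by simp [d, hj, h j hj]
    rw [key v d hd hv, key _ d hd fun j hj => by rw [reflection_apply_of_ne C hC hj, hv j hj],
      reflection_apply_self, ← palindromic_slice q hq0 hq hN hd (v i)]
    congr 2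
    push_cast
    congr 1
    refine sum_congr rfl fun j _ => ?_
    rcases eq_or_ne j i with rfl | hj
    · simp [hd, hC]
    · rw [hCN, hv j hj]; push_cast; rfl
  · push Not at h
    obtain ⟨j, hj, hlt⟩ := h
    rw [zcoeff_of_not_nonneg (v := v) fun h' => not_le.2 hlt (h' j),
      zcoeff_of_not_nonneg fun h' => ?_]
    have := h' j
    rw [reflection_apply_of_ne C hC hj] at this
    exact not_le.2 hlt this

theorem eq_one_of_corresponds {H : MvPowerSeries ι K}
    (h0 : coeff 0 H = 1) (hH : ∀ i, Corresponds (reflection C hC i) H H)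
    (hpos : ∀ d : ι →₀ ℕ, d ≠ 0 → ∃ i, ∑ j, C i j * d j < 2 * d i) : H = 1 := by
  ext d
  rw [coeff_one]
  split_ifs with hd
  · rw [hd, h0]
  induction hn : d.degree using Nat.strong_induction_on generalizing d with
  | _ n ih =>
  obtain ⟨i, hi⟩ := hpos d hd
  rw [← zcoeff_intExp, ← hH i]
  by_cases hv : 0 ≤ reflection C hC i (intExp d)
  · obtain ⟨d', hd'⟩ := exists_intExp_eq hv
    rw [← hd', zcoeff_intExp]
    refine ih d'.degree ?_ d' ?_ rfl
    · have h1 (j : ι) (hj : j ≠ i) : d' j = d j := by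
        have := congrFun hd' j
        rw [reflection_apply_of_ne C hC hj] at this
        simpa [intExp] using this
      have h2 : d' i < d i := by
        have := congrFun hd' i
        rw [reflection_apply_self] at this
        simp only [intExp] at this
        zify at hi ⊢
        omega
      rw [← hn, Finsupp.degree_eq_sum, Finsupp.degree_eq_sum]
      refine sum_lt_sum (fun j _ => ?_) ⟨i, mem_univ i, h2⟩
      rcases eq_or_ne j i with rfl | hj
      · exact h2.le
      · exact (h1 j hj).le
    · rintro rfl
      apply hd
      apply intExp_injective
      have h3 : intExp (0 : ι →₀ ℕ) = 0 := rfl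
      rw [h3] at hd' ⊢
      exact ((reflection C hC i).map_eq_zero_iff.1 hd'.symm)
  · exact zcoeff_of_not_nonneg hv _

/-- The product formula for the generating series of multivariable partition sums
attached to a finite-type graph with set of positive roots `Φ`. -/
theorem graphSeries_eq_prod (hq0 : q ≠ 0) (hq : ∀ n, q ^ (n + 1) ≠ 1)
    (hCN : ∀ i j, C i j = N i j + N j i)
    (hpos : ∀ d : ι →₀ ℕ, d ≠ 0 → ∃ i, ∑ j, C i j * d j < 2 * d i)
    (Φ : Finset (ι →₀ ℕ)) (hΦ0 : ∀ c ∈ Φ, c ≠ 0) (hΦs : ∀ i, Finsupp.single i 1 ∈ Φ)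
    (hΦ : ∀ i, ∀ c ∈ Φ, c ≠ Finsupp.single i 1 →
      ∃ c' ∈ Φ, c' ≠ Finsupp.single i 1 ∧ intExp c' = reflection C hC i (intExp c)) :
    graphSeries q N = ∏ c ∈ Φ, substMonomial c (genSeries q 0) := by
  have hf : PowerSeries.constantCoeff (genSeries q 0) = 1 := by
    rw [← PowerSeries.coeff_zero_eq_constantCoeff, coeff_zero_genSeries]
  have hfe : genSeries q 0 * (genSeries q 0)⁻¹ = 1 :=
    PowerSeries.mul_inv_cancel _ (by rw [hf]; exact one_ne_zero)
  set e := (genSeries q 0)⁻¹ with he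
  have hprod : (∏ c ∈ Φ, substMonomial c (genSeries q 0)) * ∏ c ∈ Φ, substMonomial c e = 1 := by
    rw [← prod_mul_distrib]
    refine prod_eq_one fun c hc => ?_
    rw [← substMonomial_mul (hΦ0 c hc), hfe, substMonomial_one (hΦ0 c hc)]
  have hH : graphSeries q N * ∏ c ∈ Φ, substMonomial c e = 1 := by
    refine eq_one_of_corresponds C hC ?_ (fun i => ?_) hpos
    · rw [coeff_zero_eq_constantCoeff_apply, map_mul, map_prod]
      have h1 : constantCoeff (graphSeries q N) = 1 := by
        rw [← coeff_zero_eq_constantCoeff_apply, coeff_graphSeries]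
        simp only [Finsupp.coe_zero, Pi.zero_apply, partitions_zero]
        rw [Fintype.piFinset_singleton, sum_singleton]
        simp [graphWeight, pair_zero_left, invFactorials]
      rw [h1, one_mul]
      refine prod_eq_one fun c hc => ?_
      rw [constantCoeff_substMonomial (hΦ0 c hc), he, PowerSeries.constantCoeff_inv, hf, inv_one]
    · rw [← Finset.mul_prod_erase _ _ (hΦs i), ← mul_assoc]
      refine (corresponds_graphSeries_mul q C hC hq0 hq hCN i).mul ?_
      have hex : ∀ c ∈ Φ.erase (Finsupp.single i 1), ∃ c' ∈ Φ.erase (Finsupp.single i 1),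
          intExp c' = reflection C hC i (intExp c) := fun c hc => by
        obtain ⟨c', h1, h2, h3⟩ := hΦ i c (mem_of_mem_erase hc) (ne_of_mem_erase hc)
        exact ⟨c', mem_erase.2 ⟨h2, h1⟩, h3⟩
      choose! σ hσ hσ' using hex
      have h1 : ∏ c ∈ Φ.erase (Finsupp.single i 1), substMonomial c e =
          ∏ c ∈ Φ.erase (Finsupp.single i 1), substMonomial (σ c) e := by
        refine prod_bij' (fun c _ => σ c) (fun c _ => σ c) (fun c hc => hσ c hc)
          (fun c hc => hσ c hc) ?_ ?_ ?_
        all_goals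
          intro c hc
          have h : σ (σ c) = c := intExp_injective (by
            rw [hσ' _ (hσ c hc), hσ' c hc, reflection_reflection])
        · exact h
        · exact h
        · rw [h]
      rw [show (∏ c ∈ Φ.erase (Finsupp.single i 1), substMonomial c e) = _ from rfl]
      conv => arg 3; rw [h1]
      refine .prod fun c hc => corresponds_substMonomial (hΦ0 c (mem_of_mem_erase hc))
        (hΦ0 _ (mem_of_mem_erase (hσ c hc))) (hσ' c hc) e
  calc graphSeries q N = graphSeries q N *
        ((∏ c ∈ Φ, substMonomial c (genSeries q 0)) * ∏ c ∈ Φ, substMonomial c e) := by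
          rw [hprod, mul_one]
    _ = (graphSeries q N * ∏ c ∈ Φ, substMonomial c e) *
        ∏ c ∈ Φ, substMonomial c (genSeries q 0) := by ring
    _ = _ := by rw [hH, one_mul]

end Partition

namespace E7

open Finset MvPowerSeries

/-- Half of the quadratic form of the Cartan matrix of type `E₇`. -/
def form (v : Fin 7 → ℤ) : ℤ :=
  ∑ i, v i ^ 2 - (v 0 * v 1 + v 1 * v 2 + v 2 * v 3 + v 3 * v 4 + v 4 * v 5 + v 2 * v 6)

theorem sum_cartanE7 (v : Fin 7 → ℤ) : ∑ i, ∑ j, v i * cartanE7 i j * v j = 2 * form v := by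
  simp [form, cartanE7, Fin.sum_univ_succ]
  ring

theorem form_sos (v : Fin 7 → ℤ) :
    24 * form v = 6 * (2 * v 0 - v 1) ^ 2 + 2 * (3 * v 1 - 2 * v 2) ^ 2 +
      6 * (2 * v 5 - v 4) ^ 2 + 2 * (3 * v 4 - 2 * v 3) ^ 2 + (4 * v 3 - 3 * v 2) ^ 2 +
      6 * (2 * v 6 - v 2) ^ 2 + v 2 ^ 2 := by
  simp only [form, Fin.sum_univ_seven]
  ring

theorem form_nonneg (v : Fin 7 → ℤ) : 0 ≤ form v := by
  have h := form_sos v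
  have : 0 ≤ 24 * form v := by rw [h]; positivity
  omega

theorem eq_zero_of_form_eq_zero {v : Fin 7 → ℤ} (hv : form v = 0) : v = 0 := by
  have h := form_sos v
  rw [hv] at h
  have h0 := sq_nonneg (2 * v 0 - v 1)
  have h1 := sq_nonneg (3 * v 1 - 2 * v 2)
  have h5 := sq_nonneg (2 * v 5 - v 4)
  have h4 := sq_nonneg (3 * v 4 - 2 * v 3)
  have h3 := sq_nonneg (4 * v 3 - 3 * v 2)
  have h6 := sq_nonneg (2 * v 6 - v 2)
  have h2 := sq_nonneg (v 2)
  have e0 := pow_eq_zero_iff (two_ne_zero) |>.1 (show (2 * v 0 - v 1) ^ 2 = 0 by linarith)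
  have e1 := pow_eq_zero_iff (two_ne_zero) |>.1 (show (3 * v 1 - 2 * v 2) ^ 2 = 0 by linarith)
  have e5 := pow_eq_zero_iff (two_ne_zero) |>.1 (show (2 * v 5 - v 4) ^ 2 = 0 by linarith)
  have e4 := pow_eq_zero_iff (two_ne_zero) |>.1 (show (3 * v 4 - 2 * v 3) ^ 2 = 0 by linarith)
  have e3 := pow_eq_zero_iff (two_ne_zero) |>.1 (show (4 * v 3 - 3 * v 2) ^ 2 = 0 by linarith)
  have e6 := pow_eq_zero_iff (two_ne_zero) |>.1 (show (2 * v 6 - v 2) ^ 2 = 0 by linarith)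
  have e2 := pow_eq_zero_iff (two_ne_zero) |>.1 (show v 2 ^ 2 = 0 by linarith)
  ext i
  fin_cases i <;> simp <;> omega

/-- The oriented edges of the Dynkin diagram of type `E₇`. -/
def edges : Fin 7 → Fin 7 → ℕ :=
  !![0, 1, 0, 0, 0, 0, 0;
     0, 0, 1, 0, 0, 0, 0;
     0, 0, 0, 1, 0, 0, 1;
     0, 0, 0, 0, 1, 0, 0;
     0, 0, 0, 0, 0, 1, 0;
     0, 0, 0, 0, 0, 0, 0;
     0, 0, 0, 0, 0, 0, 0]

/-- The adjacency matrix of the Dynkin diagram of type `E₇`. -/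
def adj (i j : Fin 7) : ℕ := edges i j + edges j i

theorem adj_self (i : Fin 7) : adj i i = 0 := by
  fin_cases i <;> rfl

theorem sum_edges {M : Type*} [CommSemiring M] (f : Fin 7 → Fin 7 → M) :
    ∑ i, ∑ j, edges i j * f i j = f 0 1 + f 1 2 + f 2 3 + f 3 4 + f 4 5 + f 2 6 := by
  simp [edges, Fin.sum_univ_succ]
  ring

theorem form_update (u : Fin 7 → ℤ) (i : Fin 7) (hu : u i = 0) (x : ℤ) :
    form (Function.update u i x) = form u + x ^ 2 - x * ∑ j, adj i j * u j := by
  fin_cases i <;> simp at hu <;>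
    simp [form, adj, edges, Fin.sum_univ_succ, Function.update, hu] <;> ring

theorem sum_mul_eq_form (v : Fin 7 → ℤ) :
    ∑ i, v i * (2 * v i - ∑ j, adj i j * v j) = 2 * form v := by
  simp [form, adj, edges, Fin.sum_univ_succ]
  ring

theorem exists_sum_lt (d : Fin 7 →₀ ℕ) (hd : d ≠ 0) : ∃ i, ∑ j, adj i j * d j < 2 * d i := by
  by_contra! h
  have h1 : form (intExp d) ≤ 0 := by
    have h2 := sum_mul_eq_form (intExp d)
    have h3 : ∑ i, intExp d i * (2 * intExp d i - ∑ j, adj i j * intExp d j) ≤ 0 := by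
      refine sum_nonpos fun i _ => mul_nonpos_of_nonneg_of_nonpos (by simp [intExp]) ?_
      have := h i
      zify at this
      simp only [intExp]
      linarith
    omega
  have h4 := eq_zero_of_form_eq_zero (le_antisymm h1 (form_nonneg _))
  exact hd (intExp_injective h4)

theorem form_reflection (i : Fin 7) (v : Fin 7 → ℤ) :
    form (Partition.reflection adj adj_self i v) = form v := by
  have h1 : v = Function.update (Function.update v i 0) i (v i) := by simp
  have h2 : Partition.reflection adj adj_self i v =
      Function.update (Function.update v i 0) i (∑ j, adj i j * v j - v i) := by
    simp [Partition.reflection]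
  have h3 : ∑ j, (adj i j : ℤ) * Function.update v i 0 j = ∑ j, adj i j * v j := by
    refine sum_congr rfl fun j _ => ?_
    rcases eq_or_ne j i with rfl | hj
    · simp [adj_self]
    · simp [hj]
  rw [h2, form_update _ i (by simp), h3]
  conv_rhs => rw [h1, form_update _ i (by simp), h3]
  ring

theorem form_single (i : Fin 7) : form (intExp (Finsupp.single i 1)) = 1 := by
  fin_cases i <;> simp [form, intExp, Finsupp.single_apply]

/-- The reflection at `i` permutes the positive roots other than `eᵢ`. -/
theorem exists_reflection {c : Fin 7 →₀ ℕ} (hc : form (intExp c) = 1) {i : Fin 7}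
    (hi : c ≠ Finsupp.single i 1) : ∃ c' : Fin 7 →₀ ℕ, form (intExp c') = 1 ∧
      c' ≠ Finsupp.single i 1 ∧ intExp c' = Partition.reflection adj adj_self i (intExp c) := by
  set w := Partition.reflection adj adj_self i (intExp c) with hw
  have hwc (j : Fin 7) (hj : j ≠ i) : w j = c j := Partition.reflection_apply_of_ne _ _ hj _
  have hwf : form w = 1 := by rw [hw, form_reflection, hc]
  have hpos : 0 ≤ w := by
    intro j
    rcases eq_or_ne j i with rfl | hj
    swap
    · simp [hwc j hj]
    by_contra hneg
    simp only [Pi.zero_apply, not_le] at hneg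
    have h1 := form_update (Function.update w j 0) j (by simp) (w j)
    simp only [Function.update_idem, Function.update_eq_self] at h1
    have h2 : 0 ≤ ∑ k, (adj j k : ℤ) * Function.update w j 0 k := by
      refine sum_nonneg fun k _ => mul_nonneg (by positivity) ?_
      rcases eq_or_ne k j with rfl | hk
      · simp
      · simp [hk, hwc k hk]
    have h3 := form_nonneg (Function.update w j 0)
    have h4 := eq_zero_of_form_eq_zero (v := Function.update w j 0) (by nlinarith)
    have h5 (k : Fin 7) (hk : k ≠ j) : c k = 0 := by
      have := congrFun h4 k
      simp only [Function.update_of_ne hk, Pi.zero_apply, hwc k hk] at this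
      exact_mod_cast this
    have h6 : intExp c = Function.update (0 : Fin 7 → ℤ) j (c j : ℤ) := by
      ext k
      rcases eq_or_ne k j with rfl | hk
      · simp [intExp]
      · simp [intExp, hk, h5 k hk]
    have h7 := form_update 0 j rfl (c j : ℤ)
    rw [← h6, hc] at h7
    simp [form] at h7
    apply hi
    ext k
    rcases eq_or_ne k j with rfl | hk
    · simp only [Finsupp.single_eq_same]
      have : c k ^ 2 = 1 := by exact_mod_cast h7.symm
      simpa using this
    · simp [h5 k hk, hk]
  obtain ⟨c', hc'⟩ := exists_intExp_eq hpos
  refine ⟨c', by rw [hc', hwf], ?_, hc'⟩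
  rintro rfl
  have h1 := congrArg (fun v => Partition.reflection adj adj_self i v i) hc'
  simp only [hw, Partition.reflection_reflection] at h1
  rw [Partition.reflection_apply_self] at h1
  have h2 : ∑ j, (adj i j : ℤ) * intExp (Finsupp.single i 1) j = 0 := by
    refine sum_eq_zero fun j _ => ?_
    rcases eq_or_ne j i with rfl | hj
    · simp [adj_self]
    · simp [intExp, hj]
  rw [h2] at h1
  simp [intExp] at h1

theorem le_of_form_eq_one {c : Fin 7 → ℕ} (hc : form (fun i => c i) = 1) :
    c 0 < 3 ∧ c 1 < 4 ∧ c 2 < 5 ∧ c 3 < 5 ∧ c 4 < 4 ∧ c 5 < 3 ∧ c 6 < 4 := by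
  have h := form_sos fun i => c i
  rw [hc] at h
  have e0 := sq_nonneg (2 * (c 0 : ℤ) - c 1)
  have e1 := sq_nonneg (3 * (c 1 : ℤ) - 2 * c 2)
  have e5 := sq_nonneg (2 * (c 5 : ℤ) - c 4)
  have e4 := sq_nonneg (3 * (c 4 : ℤ) - 2 * c 3)
  have e3 := sq_nonneg (4 * (c 3 : ℤ) - 3 * c 2)
  have e6 := sq_nonneg (2 * (c 6 : ℤ) - c 2)
  have e2 := sq_nonneg (c 2 : ℤ)
  have f0 : 2 * (c 0 : ℤ) - c 1 < 3 := by
    by_contra! hb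
    nlinarith
  have f1 : 3 * (c 1 : ℤ) - 2 * c 2 < 4 := by
    by_contra! hb
    nlinarith
  have f5 : 2 * (c 5 : ℤ) - c 4 < 3 := by
    by_contra! hb
    nlinarith
  have f4 : 3 * (c 4 : ℤ) - 2 * c 3 < 4 := by
    by_contra! hb
    nlinarith
  have f3 : 4 * (c 3 : ℤ) - 3 * c 2 < 5 := by
    by_contra! hb
    nlinarith
  have f6 : 2 * (c 6 : ℤ) - c 2 < 3 := by
    by_contra! hb
    nlinarith
  have f2 : (c 2 : ℤ) < 5 := by
    by_contra! hb
    nlinarith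
  omega

theorem card_box : ((range 3 ×ˢ range 4 ×ˢ range 5 ×ˢ range 5 ×ˢ range 4 ×ˢ range 3 ×ˢ
    range 4).filter fun x : ℕ × ℕ × ℕ × ℕ × ℕ × ℕ × ℕ => match x with
      | (a, b, c, d, e, f, g) => a * a + b * b + c * c + d * d + e * e + f * f + g * g =
        a * b + b * c + c * d + d * e + e * f + c * g + 1).card = 63 := by
  decide +kernel

theorem card_eq {Φ : Finset (Fin 7 → ℕ)} (hΦ : ∀ c, c ∈ Φ ↔ form (fun i => c i) = 1) :
    Φ.card = 63 := by
  have hform (c : Fin 7 → ℕ) : form (fun i => c i) = 1 ↔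
      c 0 * c 0 + c 1 * c 1 + c 2 * c 2 + c 3 * c 3 + c 4 * c 4 + c 5 * c 5 + c 6 * c 6 =
        c 0 * c 1 + c 1 * c 2 + c 2 * c 3 + c 3 * c 4 + c 4 * c 5 + c 2 * c 6 + 1 := by
    simp only [form, Fin.sum_univ_seven]
    zify
    constructor <;> intro h <;> linarith
  rw [← card_box]
  refine card_bij' (fun c _ => (c 0, c 1, c 2, c 3, c 4, c 5, c 6))
    (fun x _ => ![x.1, x.2.1, x.2.2.1, x.2.2.2.1, x.2.2.2.2.1, x.2.2.2.2.2.1, x.2.2.2.2.2.2])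
    ?_ ?_ ?_ ?_
  · intro c hc
    rw [hΦ] at hc
    have := le_of_form_eq_one hc
    simp only [mem_filter, mem_product, mem_range]
    exact ⟨this, (hform c).1 hc⟩
  · rintro ⟨a, b, c, d, e, f, g⟩ hx
    rw [hΦ, hform]
    exact (mem_filter.1 hx).2
  · intro c _
    ext i
    fin_cases i <;> rfl
  · intro x _
    rfl

end E7

namespace MvPowerSeries

section SplitFirst

variable {n : ℕ} {R : Type*} [CommRing R]

/-- The function underlying `splitFirst`. -/
noncomputable def splitFun (g : MvPowerSeries (Fin (n + 1)) R) :
    MvPowerSeries (Fin n) (PowerSeries R) :=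
  fun d => PowerSeries.mk fun k => coeff (d.cons k) g

theorem coeff_coeff_splitFun (g : MvPowerSeries (Fin (n + 1)) R) (d : Fin n →₀ ℕ) (k : ℕ) :
    PowerSeries.coeff k (coeff d (splitFun g)) = coeff (d.cons k) g := by
  rw [coeff_apply]
  exact PowerSeries.coeff_mk k _

/-- A power series in `n + 1` variables, as a power series in the last `n` variables whose
coefficients are power series in the first variable. -/
noncomputable def splitFirst : MvPowerSeries (Fin (n + 1)) R →+*
    MvPowerSeries (Fin n) (PowerSeries R) where
  toFun := splitFun
  map_zero' := by
    ext d k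
    simp [coeff_coeff_splitFun]
  map_one' := by
    classical
    ext d k
    rw [coeff_coeff_splitFun, ← coeff_coeff_finSuccEquiv, map_one, PowerSeries.coeff_one, coeff_one]
    split_ifs <;> simp_all [coeff_one, PowerSeries.coeff_one]
  map_add' f g := by
    ext d k
    simp [coeff_coeff_splitFun]
  map_mul' f g := by
    classical
    ext d k
    rw [coeff_mul, map_sum, coeff_coeff_splitFun, ← coeff_coeff_finSuccEquiv, map_mul,
      PowerSeries.coeff_mul, map_sum]
    simp only [coeff_mul, PowerSeries.coeff_mul, coeff_coeff_splitFun, coeff_coeff_finSuccEquiv]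
    exact Finset.sum_comm

theorem coeff_coeff_splitFirst (g : MvPowerSeries (Fin (n + 1)) R) (d : Fin n →₀ ℕ) (k : ℕ) :
    PowerSeries.coeff k (coeff d (splitFirst g)) = coeff (d.cons k) g :=
  coeff_coeff_splitFun g d k

theorem splitFirst_X_zero :
    splitFirst (X 0 : MvPowerSeries (Fin (n + 1)) R) = C PowerSeries.X := by
  classical
  ext d k
  rw [coeff_coeff_splitFirst, ← coeff_coeff_finSuccEquiv, finSuccEquiv_X_zero, coeff_C,
    PowerSeries.coeff_X]
  split_ifs <;> simp_all [coeff_one, PowerSeries.coeff_X]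

theorem splitFirst_X_succ (i : Fin n) :
    splitFirst (X i.succ : MvPowerSeries (Fin (n + 1)) R) = X i := by
  classical
  ext d k
  rw [coeff_coeff_splitFirst, ← coeff_coeff_finSuccEquiv, finSuccEquiv_X_succ, coeff_X,
    PowerSeries.coeff_C]
  split_ifs <;> simp_all [coeff_X, PowerSeries.coeff_one]

end SplitFirst

theorem map_substMonomial {ι A B : Type*} [CommRing A] [CommRing B] (φ : A →+* B) {c : ι →₀ ℕ}
    (hc : c ≠ 0) (g : PowerSeries A) :
    map φ (substMonomial c g) = substMonomial c (PowerSeries.map φ g) := by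
  ext d
  rw [coeff_map]
  by_cases h : ∃ k : ℕ, d = k • c
  · obtain ⟨k, rfl⟩ := h
    simp [coeff_smul_substMonomial hc]
  · push Not at h
    simp [coeff_substMonomial_eq_zero hc _ h]

theorem substMonomial_C_mul_X {ι A : Type*} [CommRing A] {c : ι →₀ ℕ} (hc : c ≠ 0) (a : A) :
    substMonomial c (PowerSeries.C a * PowerSeries.X) = monomial c a := by
  have h := PowerSeries.subst_smul (PowerSeries.HasSubst.monomial hc (1 : A)) a
    (PowerSeries.X : PowerSeries A)
  rw [PowerSeries.subst_X (PowerSeries.HasSubst.monomial hc _)] at h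
  rw [substMonomial, ← PowerSeries.smul_eq_C_mul, h, ← map_smul, smul_eq_mul, mul_one]

theorem prod_X_pow {ι A : Type*} [Fintype ι] [CommRing A] (c : ι →₀ ℕ) :
    ∏ i, (X i : MvPowerSeries ι A) ^ c i = monomial c 1 := by
  rw [monomial_eq', map_one, one_mul, Finsupp.prod_fintype _ _ (by simp)]

end MvPowerSeries

theorem map_qFactorial {A B : Type*} [CommRing A] [CommRing B] (φ : A →+* B) (q : A) (n : ℕ) :
    φ (qFactorial q n) = qFactorial (φ q) n := by
  simp [qFactorial]

namespace PowerSeries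

/-- The series `∑ qᵐ Yᵐ / (q;q)ₘ` over the ring of power series in `q`. -/
noncomputable def qExp : PowerSeries (PowerSeries ℤ) :=
  mk fun m => X ^ m * invOfUnit (qFactorial X m) 1

theorem qFactorial_mul_invOfUnit (m : ℕ) :
    qFactorial (X : PowerSeries ℤ) m * invOfUnit (qFactorial X m) 1 = 1 := by
  refine mul_invOfUnit _ _ ?_
  simp [qFactorial]

theorem one_sub_mul_qExp : (1 - C X * X) * qExp = rescale X qExp := by
  ext1 m
  rw [coeff_rescale, sub_mul, one_mul, map_sub, mul_assoc, coeff_C_mul]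
  rcases m with _ | m
  · simp
  · rw [coeff_succ_X_mul]
    simp only [qExp, coeff_mk]
    have h1 := qFactorial_mul_invOfUnit (m + 1)
    have h2 := qFactorial_mul_invOfUnit m
    rw [qFactorial_succ] at h1
    set a := invOfUnit (qFactorial (X : PowerSeries ℤ) m) 1
    set b := invOfUnit (qFactorial (X : PowerSeries ℤ) m * _) 1 with hb
    have h3 : a = (1 - X ^ (m + 1)) * b := by
      calc a = a * (qFactorial X m * (1 - X ^ (m + 1)) * b) := by rw [h1, mul_one]
        _ = (qFactorial X m * a) * ((1 - X ^ (m + 1)) * b) := by ring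
        _ = _ := by rw [h2, one_mul]
    rw [qFactorial_succ, ← hb, h3]
    ring

theorem prod_mul_qExp (N : ℕ) :
    (∏ n ∈ Finset.range N, (1 - C (X ^ (n + 1)) * X)) * qExp = rescale (X ^ N) qExp := by
  induction N with
  | zero => simp
  | succ N ih =>
    have h := congrArg (rescale (X ^ N : PowerSeries ℤ)) one_sub_mul_qExp
    rw [map_mul, map_sub, map_one, map_mul, rescale_X, rescale_rescale] at h
    have hC : rescale (X ^ N : PowerSeries ℤ) (C X) = C X := by
      ext1 m
      rw [coeff_rescale, coeff_C]
      split_ifs with hm <;> simp [hm]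
    rw [Finset.prod_range_succ, mul_right_comm, ih, pow_succ' X N, ← h, hC, map_mul]
    ring

theorem exists_rescale_qExp (N : ℕ) : ∃ g, rescale (X ^ N) qExp = 1 + C (X ^ N) * g := by
  refine ⟨mk fun m => if m = 0 then 0 else X ^ (N * (m - 1)) * coeff m qExp, ?_⟩
  ext1 m
  rw [coeff_rescale, map_add, coeff_C_mul, coeff_mk]
  rcases m with _ | m
  · have h := qFactorial_mul_invOfUnit 0
    simp only [qFactorial, Finset.range_zero, Finset.prod_empty, one_mul] at h
    simp [qExp, qFactorial, h]
  · simp only [coeff_one, Nat.add_eq_zero_iff, one_ne_zero, and_false, if_false, zero_add,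
      Nat.add_sub_cancel]
    ring

theorem fractionRing_X_ne_zero :
    algebraMap (PowerSeries ℤ) (FractionRing (PowerSeries ℤ)) X ≠ 0 := by
  simp

theorem fractionRing_X_pow_ne_one (n : ℕ) :
    algebraMap (PowerSeries ℤ) (FractionRing (PowerSeries ℤ)) X ^ (n + 1) ≠ 1 := by
  rw [← map_pow, Ne, ← map_one (algebraMap (PowerSeries ℤ) (FractionRing (PowerSeries ℤ))),
    (IsFractionRing.injective (PowerSeries ℤ) (FractionRing (PowerSeries ℤ))).eq_iff]
  intro h
  simpa using congrArg (constantCoeff (R := ℤ)) h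

theorem map_qExp : map (algebraMap (PowerSeries ℤ) (FractionRing (PowerSeries ℤ))) qExp =
    Partition.genSeries (algebraMap (PowerSeries ℤ) (FractionRing (PowerSeries ℤ)) X) 0 := by
  ext m
  rw [Partition.coeff_genSeries_zero fractionRing_X_ne_zero fractionRing_X_pow_ne_one, coeff_map,
    qExp, coeff_mk, map_mul, map_pow]
  congr 1
  refine (inv_eq_of_mul_eq_one_right ?_).symm
  rw [← map_qFactorial, ← map_mul, qFactorial_mul_invOfUnit, map_one]

end PowerSeries

namespace MvPowerSeries

open Filter

variable {n : ℕ}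

/-- The discrete topology on the coefficients makes limits eventually constant. -/
theorem eventually_coeff_eq {σ : Type*} {f : ℕ → MvPowerSeries σ ℤ} {g : MvPowerSeries σ ℤ}
    (h : Tendsto f atTop (nhds g)) (e : σ →₀ ℕ) : ∀ᶠ N in atTop, coeff e (f N) = coeff e g := by
  have h1 := (WithPiTopology.tendsto_iff_coeff_tendsto f atTop g).1 h e
  rwa [nhds_discrete, tendsto_pure] at h1

/-- The factor `q ^ (k + 1) * y ^ c` of the infinite product. -/
noncomputable def qMonomial (c : Fin n →₀ ℕ) (k : ℕ) : MvPowerSeries (Fin (n + 1)) ℤ :=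
  X 0 ^ (k + 1) * ∏ i, X i.succ ^ c i

theorem splitFirst_qMonomial (c : Fin n →₀ ℕ) (k : ℕ) :
    splitFirst (qMonomial c k) = monomial c (PowerSeries.X ^ (k + 1)) := by
  rw [qMonomial, map_mul, map_pow, splitFirst_X_zero, map_prod]
  simp_rw [map_pow, splitFirst_X_succ]
  rw [prod_X_pow, ← map_pow, ← smul_eq_C_mul, ← map_smul, smul_eq_mul, mul_one]

theorem isUnit_one_sub_qMonomial (c : Fin n →₀ ℕ) (k : ℕ) : IsUnit (1 - qMonomial c k) := by
  rw [isUnit_iff_constantCoeff]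
  simp [qMonomial]

theorem multipliable_inverse_one_sub (c : Fin n →₀ ℕ) :
    Multipliable fun k => Ring.inverse (1 - qMonomial c k) := by
  have h : (fun k => Ring.inverse (1 - qMonomial c k)) =
      fun k => 1 + qMonomial c k * Ring.inverse (1 - qMonomial c k) := by
    funext k
    have := Ring.mul_inverse_cancel _ (isUnit_one_sub_qMonomial c k)
    linear_combination this
  rw [h]
  refine WithPiTopology.multipliable_one_add_of_tendsto_order_atTop_nhds_top ?_
  rw [ENat.tendsto_nhds_top_iff_natCast_lt]
  intro m
  filter_upwards [eventually_ge_atTop m] with k hk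
  rw [qMonomial, mul_assoc]
  have h1 : ((k + 1 : ℕ) : ℕ∞) ≤ order (X 0 ^ (k + 1) : MvPowerSeries (Fin (n + 1)) ℤ) :=
    le_order_pow_of_constantCoeff_eq_zero _ (by simp)
  refine lt_of_lt_of_le ?_ ((h1.trans (le_add_right le_rfl)).trans le_order_mul)
  exact_mod_cast Nat.lt_succ_of_le hk

/-- The infinite product attached to one root, in split form. -/
theorem splitFirst_tprod {c : Fin n →₀ ℕ} (hc : c ≠ 0) :
    splitFirst (∏' k, Ring.inverse (1 - qMonomial c k)) = substMonomial c PowerSeries.qExp := by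
  have hev := (multipliable_inverse_one_sub c).hasProd.tendsto_prod_nat
  ext d m
  rw [coeff_coeff_splitFirst]
  obtain ⟨N, hN, hmN⟩ := ((eventually_coeff_eq hev (d.cons m)).and (eventually_gt_atTop m)).exists
  rw [← hN, ← coeff_coeff_splitFirst]
  set P := ∏ k ∈ Finset.range N, Ring.inverse (1 - qMonomial c k)
  have h1 : P * ∏ k ∈ Finset.range N, (1 - qMonomial c k) = 1 := by
    rw [← Finset.prod_mul_distrib]
    exact Finset.prod_eq_one fun k _ => Ring.inverse_mul_cancel _ (isUnit_one_sub_qMonomial c k)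
  have h2 : ∏ k ∈ Finset.range N, splitFirst (1 - qMonomial c k) =
      substMonomial c (∏ k ∈ Finset.range N,
        (1 - PowerSeries.C (PowerSeries.X ^ (k + 1)) * PowerSeries.X)) := by
    rw [substMonomial, ← PowerSeries.coe_substAlgHom (PowerSeries.HasSubst.monomial hc _), map_prod]
    refine Finset.prod_congr rfl fun k _ => ?_
    rw [map_sub, map_sub, map_one, map_one, splitFirst_qMonomial, PowerSeries.coe_substAlgHom,
      ← substMonomial_C_mul_X hc, substMonomial]
  obtain ⟨g, hg⟩ := PowerSeries.exists_rescale_qExp N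
  have h3 : substMonomial c PowerSeries.qExp =
      splitFirst P + C (PowerSeries.X ^ N) * (splitFirst P * substMonomial c g) := by
    have h4 := congrArg (substMonomial c) ((PowerSeries.prod_mul_qExp N).trans hg)
    have h5 := congrArg splitFirst h1
    rw [map_mul, map_prod splitFirst fun k => 1 - qMonomial c k, map_one] at h5
    rw [substMonomial_mul hc, ← h2] at h4
    have h6 : substMonomial c (1 + PowerSeries.C (PowerSeries.X ^ N) * g) =
        1 + C (PowerSeries.X ^ N) * substMonomial c g := by
      rw [substMonomial, PowerSeries.subst_add (PowerSeries.HasSubst.monomial hc _),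
        PowerSeries.subst_mul (PowerSeries.HasSubst.monomial hc _), PowerSeries.subst_C,
        ← substMonomial, substMonomial_one hc, ← substMonomial]
    rw [h6] at h4
    linear_combination (splitFirst P) * h4 - substMonomial c PowerSeries.qExp * h5
  rw [h3, map_add, coeff_C_mul, map_add, PowerSeries.coeff_X_pow_mul', if_neg (by omega), add_zero]

end MvPowerSeries

namespace E7

open Finset MvPowerSeries Partition

/-- The field of fractions of the power series in `q`. -/
abbrev QField : Type := FractionRing (PowerSeries ℤ)

/-- The variable `q` of `QField`. -/
noncomputable abbrev q : QField := algebraMap (PowerSeries ℤ) QField PowerSeries.X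

/-- The embedding of `ℤ[[q, y₁, …, y₇]]` in the power series in `y` over `QField`. -/
noncomputable def toField : MvPowerSeries (Fin 8) ℤ →+* MvPowerSeries (Fin 7) QField :=
  (map (algebraMap (PowerSeries ℤ) QField)).comp splitFirst

theorem coeff_toField (d : Fin 7 →₀ ℕ) (g : MvPowerSeries (Fin 8) ℤ) :
    coeff d (toField g) = algebraMap (PowerSeries ℤ) QField (coeff d (splitFirst g)) := by
  rw [toField, RingHom.comp_apply, coeff_map]

theorem toField_X_zero : toField (X 0) = C q := by
  rw [toField, RingHom.comp_apply, splitFirst_X_zero, map_C]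

theorem toField_X_succ (i : Fin 7) : toField (X i.succ) = X i := by
  rw [toField, RingHom.comp_apply, splitFirst_X_succ, map_X]

theorem toField_inverse_qFactorial (m : ℕ) :
    toField (Ring.inverse (qFactorial (X 0) m)) = C (qFactorial q m)⁻¹ := by
  have hu : IsUnit (qFactorial (X 0 : MvPowerSeries (Fin 8) ℤ) m) := by
    rw [isUnit_iff_constantCoeff]
    simp [qFactorial]
  have h1 := congrArg toField (Ring.inverse_mul_cancel _ hu)
  rw [map_mul, map_one, map_qFactorial toField, toField_X_zero, 
    ← map_qFactorial (C : QField →+* MvPowerSeries (Fin 7) QField)] at h1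
  have h2 : C (qFactorial q m) * C (σ := Fin 7) (qFactorial q m)⁻¹ = 1 := by
    rw [← map_mul, mul_inv_cancel₀ (qFactorial_ne_zero PowerSeries.fractionRing_X_pow_ne_one m),
      map_one]
  calc _ = toField (Ring.inverse (qFactorial (X 0) m)) *
      (C (qFactorial q m) * C (qFactorial q m)⁻¹) := by rw [h2, mul_one]
    _ = _ := by rw [← mul_assoc, h1, one_mul]

/-- The tuples of descending sequences, as tuples of antitone finitely supported functions. -/
noncomputable def descendingEquiv : {R : Fin 7 → ℕ →₀ ℕ // ∀ i, Antitone (R i)} ≃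
    {r : Fin 7 → ℕ → ℕ // ∀ i, IsDescending (r i)} where
  toFun R := ⟨fun i => R.1 i, fun i => ⟨R.2 i, (R.1 i).degree, fun _ ht =>
    eq_zero_of_degree_le (R.2 i) ht⟩⟩
  invFun r := ⟨fun i => Finsupp.ofSupportFinite (r.1 i) <| by
    obtain ⟨N, hN⟩ := (r.2 i).2
    refine (Set.finite_lt_nat N).subset fun t ht => ?_
    by_contra h
    exact ht (hN t (not_lt.1 h)), fun i => (r.2 i).1⟩
  left_inv R := by
    ext i t
    rfl
  right_inv r := rfl

theorem finsum_mul_eq_pair (r m : ℕ →₀ ℕ) :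
    ∑ᶠ t, (r t : ℤ) * (m t : ℤ) = pair r m := by
  rw [finsum_eq_sum_of_support_subset (s := r.support)]
  · simp [pair, Finsupp.sum]
  · intro t ht
    simp_all

variable {E : (Fin 7 → ℕ → ℕ) → ℤ}

/-- The quadratic exponent of the sum over tuples of descending sequences. -/
def IsExponent (E : (Fin 7 → ℕ → ℕ) → ℤ) : Prop := ∀ r : Fin 7 → ℕ → ℕ, E r =
  (∑ i : Fin 7, ∑ᶠ t : ℕ, (r i t : ℤ) ^ 2)
    - ∑ᶠ t : ℕ, ((r 0 t : ℤ) * (r 1 t : ℤ) + (r 1 t : ℤ) * (r 2 t : ℤ)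
        + (r 2 t : ℤ) * (r 3 t : ℤ) + (r 3 t : ℤ) * (r 4 t : ℤ)
        + (r 4 t : ℤ) * (r 5 t : ℤ) + (r 2 t : ℤ) * (r 6 t : ℤ))

theorem exponent_nonneg (hE : IsExponent E) (R : Fin 7 → ℕ →₀ ℕ) : 0 ≤ E fun i => R i := by
  have h0 : ∀ t ∉ univ.biUnion fun i => (R i).support, ∀ i, R i t = 0 := by
    intro t ht i
    by_contra h
    exact ht (mem_biUnion.2 ⟨i, mem_univ _, Finsupp.mem_support_iff.2 h⟩)
  have h1 : ∀ i, ∑ᶠ t, (R i t : ℤ) ^ 2 =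
      ∑ t ∈ univ.biUnion fun i => (R i).support, (R i t : ℤ) ^ 2 := fun i =>
    finsum_eq_sum_of_support_subset _ fun t ht => by
      by_contra h
      exact ht (by simp [h0 t h])
  rw [hE, sum_congr rfl fun i _ => h1 i, finsum_eq_sum_of_support_subset
    (s := univ.biUnion fun i => (R i).support), sum_comm, ← sum_sub_distrib]
  · exact sum_nonneg fun t _ => form_nonneg fun i => (R i t : ℤ)
  · intro t ht
    by_contra h
    exact ht (by simp [h0 t h])

theorem exponent_eq (hE : IsExponent E) (R : Fin 7 → ℕ →₀ ℕ) : (E fun i => R i) =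
    ((∑ i, pair (R i) (R i) : ℕ) : ℤ) - ((∑ i, ∑ j, edges i j * pair (R i) (R j) : ℕ) : ℤ) := by
  have hf : ∀ i j, (Function.support fun t => (R i t : ℤ) * (R j t : ℤ)).Finite := fun i j =>
    (R i).hasFiniteSupport.subset fun t ht => by
      simp_all
  rw [hE]
  congr 1
  · push_cast
    refine sum_congr rfl fun i _ => ?_
    rw [← finsum_mul_eq_pair]
    simp_rw [sq]
  · have h := sum_edges fun i j => pair (R i) (R j)
    simp only [Nat.cast_id] at h
    rw [h]
    push_cast
    simp only [← finsum_mul_eq_pair]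
    have h2 := (hf 0 1).union (hf 1 2)
    have h3 := h2.union (hf 2 3)
    have h4 := h3.union (hf 3 4)
    have h5 := h4.union (hf 4 5)
    have hs : ∀ {f g : ℕ → ℤ} {s : Set ℕ}, Function.support f ⊆ s →
        Function.support (fun t => f t + g t) ⊆ s ∪ Function.support g := fun hf =>
      (Function.support_add _ _).trans (Set.union_subset_union_left _ hf)
    rw [finsum_add_distrib (h5.subset (hs (hs (hs (hs subset_rfl))))) (hf 2 6),
      finsum_add_distrib (h4.subset (hs (hs (hs subset_rfl)))) (hf 4 5),
      finsum_add_distrib (h3.subset (hs (hs subset_rfl))) (hf 3 4),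
      finsum_add_distrib (h2.subset (hs subset_rfl)) (hf 2 3),
      finsum_add_distrib (hf 0 1) (hf 1 2)]

/-- The summand attached to a tuple of descending sequences. -/
noncomputable def summand (E : (Fin 7 → ℕ → ℕ) → ℤ) (r : Fin 7 → ℕ → ℕ) : MvPowerSeries (Fin 8) ℤ :=
  X 0 ^ (E r).toNat * (∏ i : Fin 7, X i.succ ^ (∑ᶠ t : ℕ, r i t)) *
    ∏ i : Fin 7, ∏ᶠ j : ℕ, Ring.inverse (∏ u ∈ range (r i j - r i (j + 1)), (1 - X 0 ^ (u + 1)))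

theorem toField_summand (hE : IsExponent E) (R : Fin 7 → ℕ →₀ ℕ) :
    toField (summand E fun i => R i) =
      monomial (Finsupp.equivFunOnFinite.symm fun i => (R i).degree) (graphWeight q edges R) := by
  have h1 : ∀ i, toField (∏ᶠ j : ℕ, Ring.inverse
      (∏ u ∈ range (R i j - R i (j + 1)), (1 - X 0 ^ (u + 1)))) = C (invFactorials q (R i)) := by
    intro i
    rw [finprod_eq_prod_of_mulSupport_subset (s := (R i).support), map_prod, invFactorials, map_prod]
    · exact prod_congr rfl fun j _ => toField_inverse_qFactorial _
    · intro j hj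
      by_contra h
      exact hj (by simp_all)
  have h2 : ∀ i, ∑ᶠ t, R i t = (R i).degree := fun i => by
    rw [finsum_eq_sum_of_support_subset (s := (R i).support), Finsupp.degree_apply]
    simp
  have h3 : q ^ (E fun i => R i).toNat =
      (∏ j, q ^ pair (R j) (R j)) * q⁻¹ ^ ∑ a, ∑ b, edges a b * pair (R a) (R b) := by
    have h4 := exponent_nonneg hE R
    rw [exponent_eq hE R] at h4 ⊢
    rw [prod_pow_eq_pow_sum, inv_pow, eq_mul_inv_iff_mul_eq₀
      (pow_ne_zero _ PowerSeries.fractionRing_X_ne_zero), ← pow_add]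
    congr 1
    omega
  have h5 := prod_X_pow (A := QField) (Finsupp.equivFunOnFinite.symm fun i => (R i).degree)
  simp only [Finsupp.equivFunOnFinite_symm_apply_apply] at h5
  have h6 : toField (∏ i : Fin 7, X i.succ ^ (∑ᶠ t : ℕ, R i t)) = monomial
      (Finsupp.equivFunOnFinite.symm fun i => (R i).degree) (1 : QField) := by
    rw [map_prod, ← h5]
    refine prod_congr rfl fun i _ => ?_
    rw [h2, map_pow]
    exact congrArg (· ^ (R i).degree) (toField_X_succ i)
  rw [summand, map_mul, map_mul, h6, map_pow, toField_X_zero, map_prod,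
    prod_congr rfl fun i _ => h1 i, graphWeight, prod_mul_distrib, mul_right_comm (∏ j, q ^ _), ← h3, ← map_prod, ← map_pow,
    mul_right_comm, ← map_mul, ← smul_eq_C_mul, ← map_smul, smul_eq_mul, mul_one]

theorem hasSum_summand (hE : IsExponent E) {L : MvPowerSeries (Fin 8) ℤ}
    (hL : toField L = graphSeries q edges) :
    HasSum (fun r : {r : Fin 7 → ℕ → ℕ // ∀ i, IsDescending (r i)} => summand E r.1) L := by
  classical
  refine descendingEquiv.hasSum_iff.1 (WithPiTopology.hasSum_iff_hasSum_coeff.2 fun e => ?_)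
  obtain ⟨k, d, rfl⟩ : ∃ k d, e = Finsupp.cons k d := ⟨_, _, (Finsupp.cons_tail e).symm⟩
  have hinj := IsFractionRing.injective (PowerSeries ℤ) QField
  have hdeg : ∀ R : Fin 7 → ℕ →₀ ℕ, (∀ i, Antitone (R i)) →
      (d = (Finsupp.equivFunOnFinite.symm fun i => (R i).degree) ↔
        R ∈ Fintype.piFinset fun j => partitions (d j)) := by
    intro R hR
    simp [mem_partitions, hR, DFunLike.ext_iff, eq_comm]
  set T := Finset.subtype (fun R : Fin 7 → ℕ →₀ ℕ => ∀ i, Antitone (R i))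
    (Fintype.piFinset fun j => partitions (d j))
  have hsum : ∑ R ∈ T, coeff d (splitFirst (summand E fun i => R.1 i)) = coeff d (splitFirst L) := by
    apply hinj
    rw [map_sum, ← coeff_toField, hL, coeff_graphSeries]
    simp only [← coeff_toField, toField_summand hE, coeff_monomial]
    rw [sum_congr rfl (g := fun R => graphWeight q edges R.1) fun R hR => if_pos
      ((hdeg _ R.2).2 (mem_subtype.1 hR))]
    exact sum_subtype_of_mem (graphWeight q edges) fun R hR j =>
      (mem_partitions.1 (Fintype.mem_piFinset.1 hR j)).1
  rw [← coeff_coeff_splitFirst, ← hsum, map_sum]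
  simp only [Function.comp_apply, ← coeff_coeff_splitFirst]
  refine hasSum_sum_of_ne_finset_zero fun R hR => ?_
  have : coeff d (splitFirst (summand E fun i => R.1 i)) = 0 := by
    apply hinj
    rw [← coeff_toField, toField_summand hE, coeff_monomial, if_neg, map_zero]
    rw [hdeg _ R.2]
    simpa [T] using hR
  exact (congrArg _ this).trans (map_zero _)

end E7

namespace E7

open Finset MvPowerSeries Partition

theorem toField_tprod {c : Fin 7 →₀ ℕ} (hc : c ≠ 0) :
    toField (∏' k, Ring.inverse (1 - qMonomial c k)) = substMonomial c (genSeries q 0) := by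
  rw [toField, RingHom.comp_apply, splitFirst_tprod hc, map_substMonomial _ hc,
    PowerSeries.map_qExp]

theorem toField_prod {Φ : Finset (Fin 7 → ℕ)} (hΦ : ∀ c, c ∈ Φ ↔ form (fun i => c i) = 1) :
    toField (∏ c ∈ Φ, ∏' n : ℕ,
      Ring.inverse (1 - (X 0 : MvPowerSeries (Fin 8) ℤ) ^ (n + 1)
        * ∏ i : Fin 7, (X i.succ : MvPowerSeries (Fin 8) ℤ) ^ c i)) = graphSeries q edges := by
  have hmem : ∀ c : Fin 7 →₀ ℕ,
      c ∈ Φ.map Finsupp.equivFunOnFinite.symm.toEmbedding ↔ form (intExp c) = 1 := by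
    intro c
    rw [mem_map_equiv, hΦ]
    rfl
  have h0 : ∀ c ∈ Φ.map Finsupp.equivFunOnFinite.symm.toEmbedding, c ≠ 0 := by
    rintro c hc rfl
    rw [hmem] at hc
    simp [intExp, form] at hc
  rw [graphSeries_eq_prod q adj adj_self PowerSeries.fractionRing_X_ne_zero
    PowerSeries.fractionRing_X_pow_ne_one (fun _ _ => rfl) exists_sum_lt
    (Φ.map Finsupp.equivFunOnFinite.symm.toEmbedding) h0
    (fun i => (hmem _).2 (form_single i)), prod_map, map_prod]
  · refine prod_congr rfl fun c hc => ?_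
    have h := toField_tprod (h0 _ (mem_map_of_mem _ hc))
    simp only [qMonomial, Equiv.coe_toEmbedding, Finsupp.equivFunOnFinite_symm_apply_apply] at h
    exact h
  · intro i c hc hi
    obtain ⟨c', h1, h2, h3⟩ := exists_reflection ((hmem c).1 hc) hi
    exact ⟨c', (hmem c').2 h1, h2, h3⟩

end E7

/-- The identity of Theorem 7.3 in type `E₇`.  With
`Φ⁺ = {c ∈ ℕ⁷ : cᵀ A c = 2}` (the 63 positive roots of `E₇`), in `ℤ[[q, y₁, …, y₇]]`
(variables indexed by `Fin 8`, `q = X 0`, `yᵢ = X i.succ`):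
`∏_{c ∈ Φ⁺} ∏_{n ≥ 1} (1 - qⁿ y^c)⁻¹
  = ∑_{(r₁,…,r₇) descending} q^{E r} (∏ᵢ yᵢ^{|rᵢ|}) ∏ᵢ ∏_{j ≥ 1} (q;q)_{rᵢ^{(j)}-rᵢ^{(j+1)}}⁻¹`,
with `E r = ∑_{i=1}^{7} ∑_{t≥1} (rᵢ^{(t)})²
 - ∑_{t≥1} (r₁r₂ + r₂r₃ + r₃r₄ + r₄r₅ + r₅r₆ + r₃r₇)^{(t)}`, a nonnegative integer. -/
theorem stmt_10
    (Φ : Finset (Fin 7 → ℕ))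
    (hΦ : ∀ c : Fin 7 → ℕ, c ∈ Φ ↔ ∑ i, ∑ j, (c i : ℤ) * cartanE7 i j * (c j : ℤ) = 2)
    (E : (Fin 7 → ℕ → ℕ) → ℤ)
    (hE : ∀ r : Fin 7 → ℕ → ℕ, E r =
      (∑ i : Fin 7, ∑ᶠ t : ℕ, (r i t : ℤ) ^ 2)
        - ∑ᶠ t : ℕ, ((r 0 t : ℤ) * (r 1 t : ℤ) + (r 1 t : ℤ) * (r 2 t : ℤ)
            + (r 2 t : ℤ) * (r 3 t : ℤ) + (r 3 t : ℤ) * (r 4 t : ℤ)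
            + (r 4 t : ℤ) * (r 5 t : ℤ) + (r 2 t : ℤ) * (r 6 t : ℤ))) :
    Φ.card = 63
    ∧ (∀ r : Fin 7 → ℕ → ℕ, (∀ i, IsDescending (r i)) → 0 ≤ E r)
    ∧ (∏ c ∈ Φ, ∏' n : ℕ,
          Ring.inverse (1 - (X 0 : MvPowerSeries (Fin 8) ℤ) ^ (n + 1)
            * ∏ i : Fin 7, (X i.succ : MvPowerSeries (Fin 8) ℤ) ^ c i))
      = ∑' r : {r : Fin 7 → ℕ → ℕ // ∀ i, IsDescending (r i)},
          (X 0 : MvPowerSeries (Fin 8) ℤ) ^ (E r.1).toNat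
            * (∏ i : Fin 7, (X i.succ : MvPowerSeries (Fin 8) ℤ) ^ (∑ᶠ t : ℕ, r.1 i t))
            * ∏ i : Fin 7, ∏ᶠ j : ℕ,
                Ring.inverse (∏ u ∈ Finset.range (r.1 i j - r.1 i (j + 1)),
                  (1 - (X 0 : MvPowerSeries (Fin 8) ℤ) ^ (u + 1))) := by
  have hΦ' : ∀ c, c ∈ Φ ↔ E7.form (fun i => c i) = 1 := fun c => by
    rw [hΦ, E7.sum_cartanE7 fun i => (c i : ℤ)]
    omega
  refine ⟨E7.card_eq hΦ', fun r hr => ?_, ?_⟩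
  · exact E7.exponent_nonneg hE (E7.descendingEquiv.symm ⟨r, hr⟩).1
  · have : T2Space (MvPowerSeries (Fin 8) ℤ) := WithPiTopology.instT2Space
    exact (E7.hasSum_summand hE (E7.toField_prod hΦ')).tsum_eq.symm
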